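/- arXiv:1905.10586 — 2 statements merged into one kernel-verified Lean document; each statement's English description precedes it below -/
import Mathlib

section
/- Let W1 and W2 be bounded weak solutions of the fractional diffusion equation with interface, both with the same bounded initial datum W0, and suppose both belong to the class 𝔉_T, i.e. for i = 1,2 there is a constant T_i' with W_i − T_i' ∈ C([0,∞); L²(ℝ)) and W_i − T ∈ L²_loc([0,∞); ℋ0). Then W1(t,·) = W2(t,·) almost everywhere on ℝ for every t ≥ 0. -/
open MeasureTheory Real Set Filter Topology

noncomputable section

/-- The fractional kernel `q_β(y) = c_β/|y|^{2+1/β}`. -/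
def qbeta (β cβ : ℝ) (y : ℝ) : ℝ := cβ / |y| ^ (2 + 1/β)

/-- The fractional Laplacian `Λ_β` on test functions, defined as a principal value. -/
def pvLambda (β cβ : ℝ) (G : ℝ → ℝ) (y : ℝ) : ℝ :=
  limUnder (nhdsWithin (0:ℝ) (Set.Ioi 0))
    (fun ε => ∫ y' in {y' : ℝ | ε < |y - y'|}, qbeta β cβ (y - y') * (G y - G y'))

/-- Test functions `G ∈ C_c^∞` on `ℝ×(ℝ\{0})`: smooth, compactly supported, with
support bounded away from the interface `y = 0`. -/
def IsTestFn (G : ℝ → ℝ → ℝ) : Prop :=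
  ContDiff ℝ (⊤ : ℕ∞) (Function.uncurry G) ∧ HasCompactSupport (Function.uncurry G) ∧
    tsupport (Function.uncurry G) ⊆ {p : ℝ × ℝ | p.2 ≠ 0}

/-- Weak solution of the fractional diffusion equation with interface, with
absorption temperature `T`. -/
def IsWeakSolution (β cβ chat pm g0 T : ℝ) (W0 : ℝ → ℝ) (W : ℝ → ℝ → ℝ) : Prop :=
  ∀ t0 : ℝ, 0 < t0 → ∀ G : ℝ → ℝ → ℝ, IsTestFn G →
    0 = (∫ t in Set.Ioc (0:ℝ) t0, ∫ y : ℝ,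
          (deriv (fun s => G s y) t - chat * pvLambda β cβ (fun y' => G t y') y) * W t y)
      + chat * (∫ t in Set.Ioc (0:ℝ) t0, ∫ y : ℝ, G t y *
          (pm * (∫ y' in {y' : ℝ | y * y' < 0}, qbeta β cβ (y - y') * (W t (-y') - W t y'))
            + g0 * (∫ y' in {y' : ℝ | y * y' < 0}, qbeta β cβ (y - y') * (T - W t y'))))
      - (∫ y : ℝ, G t0 y * W t0 y) + ∫ y : ℝ, G 0 y * W0 y

/-- The squared ℋ₀-norm, with values in `[0,∞]`. -/
def HnormSq (β cβ pp pm g0 : ℝ) (G : ℝ → ℝ) : ENNReal :=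
  (∫⁻ y in Set.Ioi (0:ℝ), ∫⁻ y' in Set.Ioi (0:ℝ),
      ENNReal.ofReal (qbeta β cβ (y - y') * (G y - G y')^2))
  + (∫⁻ y in Set.Iio (0:ℝ), ∫⁻ y' in Set.Iio (0:ℝ),
      ENNReal.ofReal (qbeta β cβ (y - y') * (G y - G y')^2))
  + (∫⁻ y in Set.Ioi (0:ℝ), ∫⁻ y' in Set.Iio (0:ℝ),
      ENNReal.ofReal (qbeta β cβ (y - y') *
        (g0 * ((G y)^2 + (G y')^2) + pp * (G y - G y')^2 + pm * (G y - G (-y'))^2)))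

/-- Membership in `ℋ₀`, the completion of `C_c^∞(ℝ\{0})` in the ℋ₀-norm. -/
def MemHzero (β cβ pp pm g0 : ℝ) (G : ℝ → ℝ) : Prop :=
  ∃ φ : ℕ → ℝ → ℝ,
    (∀ n, ContDiff ℝ (⊤ : ℕ∞) (φ n) ∧ HasCompactSupport (φ n) ∧
      tsupport (φ n) ⊆ {y : ℝ | y ≠ 0}) ∧
    Filter.Tendsto (fun n => HnormSq β cβ pp pm g0 (fun y => G y - φ n y))
      Filter.atTop (nhds 0)

/-- Membership in the regularity class `𝔉_T`: there is a constant `T'` with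
`W - T' ∈ C([0,∞);L²(ℝ))`, and `W - T ∈ L²_loc([0,∞);ℋ₀)`. -/
def MemFrakH (β cβ pp pm g0 T : ℝ) (W : ℝ → ℝ → ℝ) : Prop :=
  (∃ T' : ℝ, ∃ u : ℝ → Lp ℝ 2 (volume : Measure ℝ), ContinuousOn u (Set.Ici 0) ∧
    ∀ t : ℝ, 0 ≤ t → (u t : ℝ → ℝ) =ᵐ[volume] fun y => W t y - T') ∧
  (∀ᵐ t ∂(volume.restrict (Set.Ioi (0:ℝ))),
    MemHzero β cβ pp pm g0 (fun y => W t y - T)) ∧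
  (∀ t0 : ℝ, 0 < t0 →
    (∫⁻ t in Set.Ioc (0:ℝ) t0, HnormSq β cβ pp pm g0 (fun y => W t y - T)) < ⊤)

section Kernel

variable {β cβ : ℝ}

lemma qbeta_nonneg (hcβ : 0 < cβ) (y : ℝ) : 0 ≤ qbeta β cβ y := by
  unfold qbeta; positivity

lemma qbeta_neg (y : ℝ) : qbeta β cβ (-y) = qbeta β cβ y := by
  simp [qbeta]

lemma qbeta_sub_comm (x y : ℝ) : qbeta β cβ (x - y) = qbeta β cβ (y - x) := by
  rw [← qbeta_neg, neg_sub]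

@[fun_prop]
lemma measurable_qbeta : Measurable (qbeta β cβ) := by
  unfold qbeta
  fun_prop

lemma qbeta_anti (hβ : 1 < β) (hcβ : 0 < cβ) {x y : ℝ} (hx : x ≠ 0) (hxy : |x| ≤ |y|) :
    qbeta β cβ y ≤ qbeta β cβ x := by
  have hx' : 0 < |x| := abs_pos.2 hx
  unfold qbeta
  gcongr

lemma qbeta_mul (R : ℝ) (hR : 0 < R) (y : ℝ) :
    qbeta β cβ (R * y) = (R ^ (2 + 1 / β))⁻¹ * qbeta β cβ y := by
  simp only [qbeta, abs_mul, abs_of_pos hR]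
  rw [Real.mul_rpow hR.le (abs_nonneg y)]
  simp only [div_eq_mul_inv, mul_inv]
  ring

lemma integrable_qbeta_mul_min (hβ : 1 < β) :
    Integrable (fun h : ℝ => qbeta β cβ h * min 1 (h ^ 2)) := by
  have hβ0 : 0 < β := by linarith
  have hinv : 1 / β < 1 := by rw [div_lt_one hβ0]; exact hβ
  have hinv0 : 0 < 1 / β := by positivity
  have hIoc : IntegrableOn (fun h : ℝ => qbeta β cβ h * min 1 (h ^ 2)) (Ioc 0 1) := by
    have h0 : IntegrableOn (fun h : ℝ => cβ * h ^ (-(1 / β))) (Ioc 0 1) := by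
      have := intervalIntegral.intervalIntegrable_rpow' (a := 0) (b := 1) (r := -(1 / β))
        (by linarith)
      rw [intervalIntegrable_iff_integrableOn_Ioc_of_le zero_le_one] at this
      exact this.const_mul _
    refine h0.congr_fun (fun h hh => ?_) measurableSet_Ioc
    have hpos : 0 < h := hh.1
    have hle : h ^ 2 ≤ 1 := pow_le_one₀ hpos.le hh.2
    simp only [qbeta, abs_of_pos hpos, min_eq_right hle]
    rw [Real.rpow_neg hpos.le, Real.rpow_add hpos]
    have : h ^ (2 : ℝ) = h ^ 2 := by norm_cast
    rw [this]
    have := (Real.rpow_pos_of_pos hpos (1 / β)).ne'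
    field_simp
  have hIoi1 : IntegrableOn (fun h : ℝ => qbeta β cβ h * min 1 (h ^ 2)) (Ioi 1) := by
    have h0 : IntegrableOn (fun h : ℝ => cβ * h ^ (-(2 + 1 / β))) (Ioi 1) :=
      (integrableOn_Ioi_rpow_of_lt (by linarith) one_pos).const_mul _
    refine h0.congr_fun (fun h hh => ?_) measurableSet_Ioi
    have h1 : 1 < h := hh
    have hpos : 0 < h := by linarith
    have hle : 1 ≤ h ^ 2 := one_le_pow₀ h1.le
    simp only [qbeta, abs_of_pos hpos, min_eq_left hle, mul_one]
    rw [Real.rpow_neg hpos.le, ← div_eq_mul_inv]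
  have hIoi : IntegrableOn (fun h : ℝ => qbeta β cβ h * min 1 (h ^ 2)) (Ioi 0) := by
    rw [← Ioc_union_Ioi_eq_Ioi (zero_le_one' ℝ)]
    exact hIoc.union hIoi1
  have hIio : IntegrableOn (fun h : ℝ => qbeta β cβ h * min 1 (h ^ 2)) (Iio 0) := by
    have h1 := (MeasurePreserving.integrableOn_comp_preimage
      (Measure.measurePreserving_neg (volume : Measure ℝ))
      (Homeomorph.neg ℝ).measurableEmbedding (s := Ioi 0)
      (f := fun h : ℝ => qbeta β cβ h * min 1 (h ^ 2))).2 hIoi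
    simpa [Function.comp_def, qbeta_neg] using h1
  have hIic : IntegrableOn (fun h : ℝ => qbeta β cβ h * min 1 (h ^ 2)) (Iic 0) := by
    rwa [integrableOn_Iic_iff_integrableOn_Iio]
  have := hIic.union hIoi
  rwa [Iic_union_Ioi, integrableOn_univ] at this

/-- A function of `(y, h)` that is `O(min 1 h²)` and vanishes unless one of `y`, `y ± h` lies in a
fixed ball is integrable against `q_β(h) dy dh`. -/
lemma integrable_qbeta_snd_mul (hβ : 1 < β) (hcβ : 0 < cβ) {F : ℝ × ℝ → ℝ} (hF : Measurable F)
    {C A : ℝ} (hA : 0 ≤ A) (hbd : ∀ y h, |F (y, h)| ≤ C * min 1 (h ^ 2))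
    (hsupp : ∀ y h, A < |y| → A < |y + h| → A < |y - h| → F (y, h) = 0) :
    Integrable (fun p : ℝ × ℝ => qbeta β cβ p.2 * F p) := by
  have hm : AEStronglyMeasurable (fun p : ℝ × ℝ => qbeta β cβ p.2 * F p)
      ((volume : Measure ℝ).prod (volume : Measure ℝ)) := by
    apply Measurable.aestronglyMeasurable; fun_prop
  let S : ℝ → Set ℝ := fun h =>
    Metric.closedBall 0 A ∪ Metric.closedBall (-h) A ∪ Metric.closedBall h A
  have hSm : ∀ h, MeasurableSet (S h) := fun h =>
    (measurableSet_closedBall.union measurableSet_closedBall).union measurableSet_closedBall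
  have hSvol : ∀ h, volume (S h) ≤ ENNReal.ofReal (6 * A) := by
    intro h
    refine (measure_union_le _ _).trans ?_
    refine (add_le_add (measure_union_le _ _) le_rfl).trans ?_
    simp only [Real.volume_closedBall]
    rw [← ENNReal.ofReal_add (by positivity) (by positivity),
      ← ENNReal.ofReal_add (by positivity) (by positivity)]
    apply ENNReal.ofReal_le_ofReal; linarith
  have hSfin : ∀ h, volume (S h) ≠ ⊤ := fun h =>
    ((hSvol h).trans_lt ENNReal.ofReal_lt_top).ne
  have hC : 0 ≤ C := by
    have := (abs_nonneg _).trans (hbd 0 1)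
    simpa using this
  have hdom : ∀ y h, ‖qbeta β cβ h * F (y, h)‖ ≤
      (S h).indicator (fun _ => C * (qbeta β cβ h * min 1 (h ^ 2))) y := by
    intro y h
    rw [norm_mul, Real.norm_of_nonneg (qbeta_nonneg hcβ h), Real.norm_eq_abs]
    by_cases hy : y ∈ S h
    · rw [indicator_of_mem hy]
      calc _ ≤ qbeta β cβ h * (C * min 1 (h ^ 2)) :=
            mul_le_mul_of_nonneg_left (hbd y h) (qbeta_nonneg hcβ h)
        _ = _ := by ring
    · rw [indicator_of_notMem hy]
      simp only [S, mem_union, Metric.mem_closedBall, Real.dist_eq, sub_zero, sub_neg_eq_add,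
        not_or, not_le] at hy
      rw [hsupp y h hy.1.1 hy.1.2 hy.2]; simp
  have hind : ∀ h, Integrable
      ((S h).indicator (fun _ => C * (qbeta β cβ h * min 1 (h ^ 2)))) volume := fun h =>
    (integrable_indicator_iff (hSm h)).2 (integrableOn_const (hSfin h))
  change Integrable _ ((volume : Measure ℝ).prod (volume : Measure ℝ))
  rw [integrable_prod_iff' hm]
  refine ⟨Eventually.of_forall fun h => ?_, ?_⟩
  · refine (hind h).mono' ?_ (Eventually.of_forall fun y => hdom y h)
    apply Measurable.aestronglyMeasurable; fun_prop
  · refine ((integrable_qbeta_mul_min (cβ := cβ) hβ).const_mul (6 * A * C)).mono'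
      hm.norm.prod_swap.integral_prod_right' (Eventually.of_forall fun h => ?_)
    rw [Real.norm_of_nonneg (integral_nonneg fun _ => norm_nonneg _)]
    refine (integral_mono_of_nonneg (Eventually.of_forall fun _ => norm_nonneg _) (hind h)
      (Eventually.of_forall fun y => hdom y h)).trans ?_
    rw [integral_indicator_const _ (hSm h), smul_eq_mul]
    have h1 : volume.real (S h) ≤ 6 * A := by
      rw [measureReal_def]
      exact ENNReal.toReal_le_of_le_ofReal (by positivity) (hSvol h)
    have h2 : 0 ≤ C * (qbeta β cβ h * min 1 (h ^ 2)) := by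
      have := qbeta_nonneg (β := β) hcβ h
      have : (0 : ℝ) ≤ min 1 (h ^ 2) := by positivity
      positivity
    calc _ ≤ 6 * A * (C * (qbeta β cβ h * min 1 (h ^ 2))) := mul_le_mul_of_nonneg_right h1 h2
      _ = _ := by ring

end Kernel

section SmoothFunctions

variable {β cβ : ℝ} {φ V : ℝ → ℝ}

lemma exists_forall_abs_lt_eq_zero (hc : HasCompactSupport φ) :
    ∃ A, 0 < A ∧ ∀ y, A < |y| → φ y = 0 := by
  obtain ⟨A, hA, hsub⟩ := hc.isCompact.isBounded.subset_closedBall_lt 0 0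
  refine ⟨A, hA, fun y hy => ?_⟩
  by_contra hne
  have := hsub (subset_tsupport _ hne)
  rw [Metric.mem_closedBall, Real.dist_eq, sub_zero] at this
  linarith

lemma exists_sq_increment_le (hφ : ContDiff ℝ (⊤ : ℕ∞) φ) (hc : HasCompactSupport φ) :
    ∃ C, 0 ≤ C ∧ ∀ y h, (φ (y + h) - φ y) ^ 2 ≤ C * min 1 (h ^ 2) := by
  obtain ⟨L, hL⟩ := ContDiff.lipschitzWith_of_hasCompactSupport hc hφ (by simp)
  obtain ⟨M, hM⟩ := hc.exists_bound_of_continuous hφ.continuous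
  have hM0 : 0 ≤ M := (norm_nonneg _).trans (hM 0)
  refine ⟨(2 * M) ^ 2 + L ^ 2, by positivity, fun y h => ?_⟩
  have h1 : |φ (y + h) - φ y| ≤ L * |h| := by
    have := hL.dist_le_mul (y + h) y
    simpa [Real.dist_eq] using this
  have h2 : |φ (y + h) - φ y| ≤ 2 * M := by
    have := norm_sub_le (φ (y + h)) (φ y)
    have := hM (y + h)
    have := hM y
    rw [← Real.norm_eq_abs]; linarith
  have h3 : (φ (y + h) - φ y) ^ 2 ≤ (2 * M) ^ 2 := by
    rw [← sq_abs]; gcongr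
  have h4 : (φ (y + h) - φ y) ^ 2 ≤ L ^ 2 * h ^ 2 := by
    rw [← sq_abs, ← sq_abs h, ← mul_pow]; gcongr
  rcases min_cases (1 : ℝ) (h ^ 2) with ⟨he, -⟩ | ⟨he, -⟩ <;> rw [he]
  · nlinarith [sq_nonneg (L : ℝ)]
  · nlinarith [mul_nonneg (sq_nonneg (2 * M)) (sq_nonneg h)]

lemma exists_second_difference_le (hφ : ContDiff ℝ (⊤ : ℕ∞) φ) (hc : HasCompactSupport φ) :
    ∃ C, 0 ≤ C ∧ ∀ y h, |2 * φ y - φ (y + h) - φ (y - h)| ≤ C * min 1 (h ^ 2) := by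
  have hd : ContDiff ℝ (⊤ : ℕ∞) (deriv φ) := (contDiff_infty_iff_deriv.1 hφ).2
  obtain ⟨L, hL⟩ := ContDiff.lipschitzWith_of_hasCompactSupport hc.deriv hd (by simp)
  obtain ⟨M, hM⟩ := hc.exists_bound_of_continuous hφ.continuous
  have hM0 : 0 ≤ M := (norm_nonneg _).trans (hM 0)
  have hdiff : Differentiable ℝ φ := hφ.differentiable (by simp)
  refine ⟨4 * M + 2 * L, by positivity, fun y h => ?_⟩
  have h2 : |2 * φ y - φ (y + h) - φ (y - h)| ≤ 4 * M := by
    have h1 := abs_le.1 (hM (y + h))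
    have h2 := abs_le.1 (hM y)
    have h3 := abs_le.1 (hM (y - h))
    rw [abs_le]; constructor <;> linarith [h1.1, h1.2, h2.1, h2.2, h3.1, h3.2]
  have h1 : |2 * φ y - φ (y + h) - φ (y - h)| ≤ 2 * L * h ^ 2 := by
    have hder : ∀ s, HasDerivAt (fun s => 2 * φ y - φ (y + s) - φ (y - s))
        (deriv φ (y - s) - deriv φ (y + s)) s := by
      intro s
      have e1 : HasDerivAt (fun s => φ (y + s)) (deriv φ (y + s)) s := by
        simpa using (hdiff (y + s)).hasDerivAt.comp_const_add y s
      have e2 : HasDerivAt (fun s => φ (y - s)) (-deriv φ (y - s)) s := by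
        simpa using (hdiff (y - s)).hasDerivAt.comp_const_sub y s
      convert! ((hasDerivAt_const s (2 * φ y)).sub e1).sub e2 using 1
      ring
    have := Convex.norm_image_sub_le_of_norm_deriv_le (s := Metric.closedBall (0 : ℝ) |h|)
      (f := fun s => 2 * φ y - φ (y + s) - φ (y - s)) (x := 0) (y := h) (C := 2 * L * |h|)
      (fun s _ => (hder s).differentiableAt) (fun s hs => ?_) (convex_closedBall 0 |h|)
      (by simp) (by simp)
    · simp only [add_zero, sub_zero, Real.norm_eq_abs] at this
      calc |2 * φ y - φ (y + h) - φ (y - h)|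
          = |2 * φ y - φ (y + h) - φ (y - h) - (2 * φ y - φ y - φ y)| := by congr 1; ring
        _ ≤ 2 * L * |h| * |h| := this
        _ = _ := by rw [mul_assoc, abs_mul_abs_self]; ring
    · rw [(hder s).deriv]
      have := hL.dist_le_mul (y - s) (y + s)
      rw [Real.dist_eq, Real.dist_eq] at this
      have hs' : |s| ≤ |h| := by simpa using hs
      have e : |y - s - (y + s)| = 2 * |s| := by
        rw [show y - s - (y + s) = (-2) * s by ring, abs_mul]; norm_num
      rw [e] at this
      rw [Real.norm_eq_abs]
      calc _ ≤ _ := this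
        _ = 2 * L * |s| := by ring
        _ ≤ _ := by gcongr
  rcases min_cases (1 : ℝ) (h ^ 2) with ⟨he, -⟩ | ⟨he, -⟩ <;> rw [he]
  · nlinarith [L.coe_nonneg]
  · nlinarith [mul_nonneg hM0 (sq_nonneg h)]

lemma integrable_comp_shear {F : ℝ × ℝ → ℝ} :
    Integrable (fun p : ℝ × ℝ => F (p.1, p.1 + p.2)) ↔ Integrable F :=
  (measurePreserving_prod_add (volume : Measure ℝ) (volume : Measure ℝ)).integrable_comp_emb
    (MeasurableEquiv.shearAddRight ℝ).measurableEmbedding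

lemma integral_comp_shear (F : ℝ × ℝ → ℝ) :
    ∫ p : ℝ × ℝ, F (p.1, p.1 + p.2) = ∫ p : ℝ × ℝ, F p :=
  (measurePreserving_prod_add (volume : Measure ℝ) (volume : Measure ℝ)).integral_comp
    (MeasurableEquiv.shearAddRight ℝ).measurableEmbedding F

/-- Smooth compactly supported functions have finite fractional energy. -/
lemma integrable_qbeta_sq_sub (hβ : 1 < β) (hcβ : 0 < cβ)
    (hφ : ContDiff ℝ (⊤ : ℕ∞) φ) (hc : HasCompactSupport φ) :
    Integrable (fun p : ℝ × ℝ => qbeta β cβ (p.1 - p.2) * (φ p.1 - φ p.2) ^ 2) := by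
  obtain ⟨A, hA, hA0⟩ := exists_forall_abs_lt_eq_zero hc
  obtain ⟨C, -, hC⟩ := exists_sq_increment_le hφ hc
  have hφm := hφ.continuous.measurable
  rw [← integrable_comp_shear]
  refine (integrable_qbeta_snd_mul (F := fun p => (φ (p.1 + p.2) - φ p.1) ^ 2) (C := C) hβ hcβ
    (by fun_prop) hA.le (fun y h => ?_) (fun y h h1 h2 _ => ?_)).congr
    (Eventually.of_forall fun p => ?_)
  · rw [abs_of_nonneg (sq_nonneg _)]; exact hC y h
  · simp [hA0 _ h1, hA0 _ h2]
  · simp only [sub_add_cancel_left, qbeta_neg]; ring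

lemma integrable_qbeta_second_difference (hβ : 1 < β) (hcβ : 0 < cβ)
    (hφ : ContDiff ℝ (⊤ : ℕ∞) φ) (hc : HasCompactSupport φ) :
    Integrable (fun p : ℝ × ℝ =>
      qbeta β cβ p.2 * (2 * φ p.1 - φ (p.1 + p.2) - φ (p.1 - p.2))) := by
  obtain ⟨A, hA, hA0⟩ := exists_forall_abs_lt_eq_zero hc
  obtain ⟨C, -, hC⟩ := exists_second_difference_le hφ hc
  have hφm := hφ.continuous.measurable
  refine integrable_qbeta_snd_mul (F := fun p => 2 * φ p.1 - φ (p.1 + p.2) - φ (p.1 - p.2))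
    (C := C) hβ hcβ (by fun_prop) hA.le hC (fun y h h1 h2 h3 => ?_)
  simp [hA0 _ h1, hA0 _ h2, hA0 _ h3]

/-- The principal value defining `Λ_β φ` is an absolutely convergent integral of second
differences. -/
lemma pvLambda_eq (hβ : 1 < β) (hcβ : 0 < cβ)
    (hφ : ContDiff ℝ (⊤ : ℕ∞) φ) (hc : HasCompactSupport φ) (y : ℝ) :
    pvLambda β cβ φ y =
      (1 / 2) * ∫ h, qbeta β cβ h * (2 * φ y - φ (y + h) - φ (y - h)) := by
  obtain ⟨C, hC0, hC⟩ := exists_second_difference_le hφ hc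
  obtain ⟨M, hM⟩ := hc.exists_bound_of_continuous hφ.continuous
  have hM0 : 0 ≤ M := (norm_nonneg _).trans (hM 0)
  have hφm := hφ.continuous.measurable
  apply Tendsto.limUnder_eq
  let P : ℝ → ℝ → ℝ := fun ε => {h : ℝ | ε < |h|}.indicator
    (fun h => qbeta β cβ h * (φ y - φ (y - h)))
  have hset : ∀ ε : ℝ, MeasurableSet {h : ℝ | ε < |h|} := fun ε =>
    measurableSet_lt measurable_const (by fun_prop)
  have hPm : ∀ ε, Measurable (P ε) := fun ε =>
    Measurable.indicator (by fun_prop) (hset ε)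
  have hPint : ∀ ε, 0 < ε → Integrable (P ε) := by
    intro ε hε
    refine ((integrable_qbeta_mul_min (cβ := cβ) hβ).const_mul
      (2 * M / min 1 (ε ^ 2))).mono' (hPm ε).aestronglyMeasurable
      (Eventually.of_forall fun h => ?_)
    have hq := qbeta_nonneg (β := β) hcβ h
    have hmin : 0 < min 1 (ε ^ 2) := by positivity
    by_cases hh : ε < |h|
    · have hmem : h ∈ {h : ℝ | ε < |h|} := hh
      have h1 : ‖φ y - φ (y - h)‖ ≤ 2 * M := by
        have := norm_sub_le (φ y) (φ (y - h))
        have := hM y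
        have := hM (y - h)
        linarith
      have h2 : min 1 (ε ^ 2) ≤ min 1 (h ^ 2) := by
        rw [← sq_abs h]; gcongr
      simp only [P, indicator_of_mem hmem]
      rw [norm_mul, Real.norm_of_nonneg hq]
      calc _ ≤ qbeta β cβ h * (2 * M) := by gcongr
        _ = 2 * M / min 1 (ε ^ 2) * (qbeta β cβ h * min 1 (ε ^ 2)) := by field_simp
        _ ≤ _ := by gcongr
    · have hmem : h ∉ {h : ℝ | ε < |h|} := hh
      simp only [P, indicator_of_notMem hmem, norm_zero]
      have : 0 ≤ min 1 (h ^ 2) := by positivity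
      positivity
  have hrepr : ∀ ε, 0 < ε → ∫ y' in {y' : ℝ | ε < |y - y'|},
      qbeta β cβ (y - y') * (φ y - φ y') = ∫ h, (1 / 2) * (P ε h + P ε (-h)) := by
    intro ε hε
    have hs : MeasurableSet {y' : ℝ | ε < |y - y'|} :=
      measurableSet_lt measurable_const (by fun_prop)
    rw [← integral_indicator hs]
    have e1 : ∫ y', ({y' : ℝ | ε < |y - y'|}.indicator
        (fun y' => qbeta β cβ (y - y') * (φ y - φ y'))) y' = ∫ h, P ε h := by
      rw [← integral_sub_left_eq_self (P ε) volume y]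
      refine integral_congr_ae (Eventually.of_forall fun y' => ?_)
      simp [P, indicator]
    rw [e1, integral_const_mul, integral_add (hPint ε hε) (hPint ε hε).comp_neg,
      integral_neg_eq_self (P ε) volume]
    ring
  rw [← integral_const_mul]
  have key : Tendsto (fun ε => ∫ h, (1 / 2) * (P ε h + P ε (-h))) (𝓝[>] 0)
      (𝓝 (∫ h, (1 / 2) * (qbeta β cβ h * (2 * φ y - φ (y + h) - φ (y - h))))) := by
    have hsum : ∀ ε h, P ε h + P ε (-h) = {h : ℝ | ε < |h|}.indicator
        (fun h => qbeta β cβ h * (2 * φ y - φ (y + h) - φ (y - h))) h := by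
      intro ε h
      by_cases hh : ε < |h|
      · simp only [P, indicator, mem_ofPred_eq, hh, abs_neg, qbeta_neg, if_true, sub_neg_eq_add]
        ring
      · simp [P, indicator, hh]
    refine tendsto_integral_filter_of_dominated_convergence
      (fun h => (1 / 2) * (C * (qbeta β cβ h * min 1 (h ^ 2)))) ?_ ?_ ?_ ?_
    · refine Eventually.of_forall fun ε => Measurable.aestronglyMeasurable ?_
      have := hPm ε
      fun_prop
    · refine Eventually.of_forall fun ε => Eventually.of_forall fun h => ?_
      have hq := qbeta_nonneg (β := β) hcβ h
      rw [hsum, norm_mul]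
      have : ‖({h : ℝ | ε < |h|}.indicator
        (fun h => qbeta β cβ h * (2 * φ y - φ (y + h) - φ (y - h))) h)‖ ≤
          C * (qbeta β cβ h * min 1 (h ^ 2)) := by
        refine (norm_indicator_le_norm_self _ _).trans ?_
        rw [norm_mul, Real.norm_of_nonneg hq, Real.norm_eq_abs]
        calc _ ≤ qbeta β cβ h * (C * min 1 (h ^ 2)) := by gcongr; exact hC y h
          _ = _ := by ring
      rw [Real.norm_of_nonneg (by norm_num : (0 : ℝ) ≤ 1 / 2)]
      exact mul_le_mul_of_nonneg_left this (by norm_num)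
    · exact ((integrable_qbeta_mul_min hβ).const_mul _).const_mul _
    · have hne : ∀ᵐ h : ℝ, h ≠ 0 := Measure.ae_ne volume 0
      filter_upwards [hne] with h hh
      refine tendsto_const_nhds.congr' ?_
      have hpos : 0 < |h| := abs_pos.2 hh
      filter_upwards [Ioo_mem_nhdsGT hpos] with ε hε
      rw [hsum]
      have hmem : h ∈ {h : ℝ | ε < |h|} := hε.2
      rw [indicator_of_mem hmem]
  refine key.congr' ?_
  filter_upwards [self_mem_nhdsWithin] with ε hε
  exact (hrepr ε hε).symm

lemma integrable_pvLambda (hβ : 1 < β) (hcβ : 0 < cβ)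
    (hφ : ContDiff ℝ (⊤ : ℕ∞) φ) (hc : HasCompactSupport φ) :
    Integrable (pvLambda β cβ φ) := by
  have h := (integrable_qbeta_second_difference hβ hcβ hφ hc).integral_prod_left.const_mul (1 / 2)
  exact h.congr (Eventually.of_forall fun y => (pvLambda_eq hβ hcβ hφ hc y).symm)

lemma integral_second_difference_mul (hφ : Continuous φ) (hc : HasCompactSupport φ)
    (hV : Measurable V) {M : ℝ} (hVM : ∀ y, |V y| ≤ M) (h : ℝ) :
    ∫ y, (2 * φ y - φ (y + h) - φ (y - h)) * V y =
      ∫ y, (φ (y + h) - φ y) * (V (y + h) - V y) := by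
  have hφi : Integrable φ := hφ.integrable_of_hasCompactSupport hc
  have hmul : ∀ {f : ℝ → ℝ} {u : ℝ → ℝ}, Integrable f → Measurable u → (∀ y, |u y| ≤ M) →
      Integrable (fun y => f y * u y) := fun hf hu hb =>
    hf.mul_bdd (c := M) hu.aestronglyMeasurable (Eventually.of_forall hb)
  have i1 : Integrable (fun y => (φ y - φ (y + h)) * V y) :=
    hmul (hφi.sub (hφi.comp_add_right h)) hV hVM
  have i2 : Integrable (fun y => (φ y - φ (y - h)) * V y) :=
    hmul (hφi.sub (hφi.comp_sub_right h)) hV hVM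
  have i3 : Integrable (fun y => (φ (y + h) - φ y) * V (y + h)) :=
    hmul ((hφi.comp_add_right h).sub hφi) (by fun_prop) (fun y => hVM _)
  have e : ∫ y, (φ y - φ (y - h)) * V y = ∫ y, (φ (y + h) - φ y) * V (y + h) := by
    rw [← integral_add_right_eq_self _ h]
    simp
  calc _ = ∫ y, ((φ y - φ (y + h)) * V y + (φ y - φ (y - h)) * V y) := by
        congr 1; ext y; ring
    _ = (∫ y, (φ y - φ (y + h)) * V y) + ∫ y, (φ (y + h) - φ y) * V (y + h) := by
        rw [integral_add i1 i2, e]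
    _ = ∫ y, ((φ y - φ (y + h)) * V y + (φ (y + h) - φ y) * V (y + h)) :=
        (integral_add i1 i3).symm
    _ = _ := by congr 1; ext y; ring

/-- The fractional Laplacian, paired with a function of finite energy, is the fractional
Dirichlet form. -/
lemma integral_pvLambda_mul (hβ : 1 < β) (hcβ : 0 < cβ)
    (hφ : ContDiff ℝ (⊤ : ℕ∞) φ) (hc : HasCompactSupport φ)
    (hV : Measurable V) {M : ℝ} (hVM : ∀ y, |V y| ≤ M)
    (hint : Integrable (fun p : ℝ × ℝ =>
      qbeta β cβ (p.1 - p.2) * ((φ p.1 - φ p.2) * (V p.1 - V p.2)))) :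
    ∫ y, pvLambda β cβ φ y * V y = (1 / 2) * ∫ p : ℝ × ℝ,
      qbeta β cβ (p.1 - p.2) * ((φ p.1 - φ p.2) * (V p.1 - V p.2)) := by
  have hD := integrable_qbeta_second_difference hβ hcβ hφ hc
  have hDV : Integrable (fun p : ℝ × ℝ =>
      qbeta β cβ p.2 * (2 * φ p.1 - φ (p.1 + p.2) - φ (p.1 - p.2)) * V p.1) :=
    hD.mul_bdd (c := M) (hV.comp measurable_fst).aestronglyMeasurable
      (Eventually.of_forall fun p => hVM p.1)
  calc ∫ y, pvLambda β cβ φ y * V y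
      = (1 / 2) * ∫ y, ∫ h,
          qbeta β cβ h * (2 * φ y - φ (y + h) - φ (y - h)) * V y := by
        rw [← integral_const_mul]
        congr 1; ext y
        rw [pvLambda_eq hβ hcβ hφ hc, integral_mul_const]; ring
    _ = (1 / 2) * ∫ h, ∫ y,
          qbeta β cβ h * (2 * φ y - φ (y + h) - φ (y - h)) * V y := by
        rw [integral_integral_swap]; exact hDV
    _ = (1 / 2) * ∫ h, ∫ y,
          qbeta β cβ h * ((φ (y + h) - φ y) * (V (y + h) - V y)) := by
        congr 2; ext h
        simp_rw [mul_assoc]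
        rw [integral_const_mul, integral_const_mul,
          integral_second_difference_mul hφ.continuous hc hV hVM]
    _ = (1 / 2) * ∫ p : ℝ × ℝ,
          qbeta β cβ p.2 * ((φ (p.1 + p.2) - φ p.1) * (V (p.1 + p.2) - V p.1)) := by
        congr 1
        symm
        refine integral_prod_symm (fun p : ℝ × ℝ =>
          qbeta β cβ p.2 * ((φ (p.1 + p.2) - φ p.1) * (V (p.1 + p.2) - V p.1))) ?_
        refine (integrable_comp_shear.2 hint).congr (Eventually.of_forall fun p => ?_)
        simp only [sub_add_cancel_left, qbeta_neg]; ring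
    _ = _ := by
        rw [← integral_comp_shear (fun p : ℝ × ℝ =>
          qbeta β cβ (p.1 - p.2) * ((φ p.1 - φ p.2) * (V p.1 - V p.2)))]
        congr 2; ext p
        simp only [sub_add_cancel_left, qbeta_neg]; ring

end SmoothFunctions

/-- The symmetric jump kernel of the Dirichlet form associated with the interface dynamics. -/
def jumpKernel (β cβ pp pm : ℝ) (p : ℝ × ℝ) : ℝ :=
  if 0 < p.1 * p.2 then (1 / 2) * (qbeta β cβ (p.1 - p.2) + pm * qbeta β cβ (p.1 + p.2))
  else if p.1 * p.2 < 0 then (1 / 2) * (pp * qbeta β cβ (p.1 - p.2)) else 0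

/-- The kernel whose marginal is the killing rate at the interface. -/
def killKernel (β cβ g0 : ℝ) (p : ℝ × ℝ) : ℝ :=
  if p.1 * p.2 < 0 then g0 * qbeta β cβ (p.1 - p.2) else 0

/-- The weighted increment `√k(y, y') (f(y) - f(y'))`. -/
def jumpGrad (β cβ pp pm : ℝ) (f : ℝ → ℝ) (p : ℝ × ℝ) : ℝ :=
  √(jumpKernel β cβ pp pm p) * (f p.1 - f p.2)

/-- The weighted value `√l(y, y') f(y)`. -/
def killGrad (β cβ g0 : ℝ) (f : ℝ → ℝ) (p : ℝ × ℝ) : ℝ :=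
  √(killKernel β cβ g0 p) * f p.1

/-- Finiteness of the Dirichlet energy. -/
def FiniteEnergy (β cβ pp pm g0 : ℝ) (f : ℝ → ℝ) : Prop :=
  MemLp (jumpGrad β cβ pp pm f) 2 (volume : Measure (ℝ × ℝ)) ∧
    MemLp (killGrad β cβ g0 f) 2 (volume : Measure (ℝ × ℝ))

/-- The Dirichlet form of the interface dynamics. -/
def interfaceForm (β cβ pp pm g0 : ℝ) (f g : ℝ → ℝ) : ℝ :=
  (∫ p, jumpGrad β cβ pp pm f p * jumpGrad β cβ pp pm g p) +
    ∫ p, killGrad β cβ g0 f p * killGrad β cβ g0 g p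

/-- The space `C_c^∞(ℝ \ {0})`. -/
def IsSpaceTest (φ : ℝ → ℝ) : Prop :=
  ContDiff ℝ (⊤ : ℕ∞) φ ∧ HasCompactSupport φ ∧ tsupport φ ⊆ {y : ℝ | y ≠ 0}

/-- The jump rate across the interface, weighted by `φ` at the starting point. -/
def crossing (β cβ : ℝ) (φ : ℝ → ℝ) (p : ℝ × ℝ) : ℝ :=
  if p.1 * p.2 < 0 then qbeta β cβ (p.1 - p.2) * φ p.1 else 0

section DirichletForm

variable {β cβ pp pm g0 : ℝ} {φ V f : ℝ → ℝ}

lemma measurableSet_mul_neg : MeasurableSet {p : ℝ × ℝ | p.1 * p.2 < 0} :=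
  measurableSet_lt (by fun_prop) measurable_const

lemma measurableSet_mul_pos : MeasurableSet {p : ℝ × ℝ | 0 < p.1 * p.2} :=
  measurableSet_lt measurable_const (by fun_prop)

@[fun_prop]
lemma measurable_jumpKernel : Measurable (jumpKernel β cβ pp pm) :=
  Measurable.ite measurableSet_mul_pos (by fun_prop)
    (Measurable.ite measurableSet_mul_neg (by fun_prop) measurable_const)

@[fun_prop]
lemma measurable_killKernel : Measurable (killKernel β cβ g0) :=
  Measurable.ite measurableSet_mul_neg (by fun_prop) measurable_const

lemma measurable_jumpGrad (hf : Measurable f) : Measurable (jumpGrad β cβ pp pm f) := by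
  unfold jumpGrad; fun_prop

lemma measurable_killGrad (hf : Measurable f) : Measurable (killGrad β cβ g0 f) := by
  unfold killGrad; fun_prop

lemma jumpKernel_nonneg (hcβ : 0 < cβ) (hpp : 0 ≤ pp) (hpm : 0 ≤ pm) (p : ℝ × ℝ) :
    0 ≤ jumpKernel β cβ pp pm p := by
  have h1 := qbeta_nonneg (β := β) hcβ (p.1 - p.2)
  have h2 := qbeta_nonneg (β := β) hcβ (p.1 + p.2)
  unfold jumpKernel
  split_ifs <;> positivity

lemma killKernel_nonneg (hcβ : 0 < cβ) (hg0 : 0 < g0) (p : ℝ × ℝ) :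
    0 ≤ killKernel β cβ g0 p := by
  have h1 := qbeta_nonneg (β := β) hcβ (p.1 - p.2)
  unfold killKernel
  split_ifs <;> positivity

lemma jumpKernel_le (hβ : 1 < β) (hcβ : 0 < cβ) (hpp1 : pp ≤ 1) (hpm : 0 ≤ pm) (hpm1 : pm ≤ 1)
    {p : ℝ × ℝ} (hp : p.1 ≠ p.2) :
    jumpKernel β cβ pp pm p ≤ qbeta β cβ (p.1 - p.2) := by
  have h1 := qbeta_nonneg (β := β) hcβ (p.1 - p.2)
  have h2 := qbeta_nonneg (β := β) hcβ (p.1 + p.2)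
  unfold jumpKernel
  split_ifs with h
  · have h3 : qbeta β cβ (p.1 + p.2) ≤ qbeta β cβ (p.1 - p.2) := by
      refine qbeta_anti hβ hcβ (sub_ne_zero.2 hp) ?_
      rw [← sq_le_sq]
      nlinarith
    nlinarith
  · nlinarith
  · exact h1

lemma jumpGrad_mul (hcβ : 0 < cβ) (hpp : 0 ≤ pp) (hpm : 0 ≤ pm) (f g : ℝ → ℝ) (p : ℝ × ℝ) :
    jumpGrad β cβ pp pm f p * jumpGrad β cβ pp pm g p =
      jumpKernel β cβ pp pm p * ((f p.1 - f p.2) * (g p.1 - g p.2)) := by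
  have := Real.mul_self_sqrt (jumpKernel_nonneg (β := β) hcβ hpp hpm p)
  unfold jumpGrad
  linear_combination (f p.1 - f p.2) * (g p.1 - g p.2) * this

lemma killGrad_mul (hcβ : 0 < cβ) (hg0 : 0 < g0) (f g : ℝ → ℝ) (p : ℝ × ℝ) :
    killGrad β cβ g0 f p * killGrad β cβ g0 g p =
      killKernel β cβ g0 p * (f p.1 * g p.1) := by
  have := Real.mul_self_sqrt (killKernel_nonneg (β := β) hcβ hg0 p)
  unfold killGrad
  linear_combination (f p.1 * g p.1) * this

lemma jumpGrad_sub (f g : ℝ → ℝ) (p : ℝ × ℝ) :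
    jumpGrad β cβ pp pm (fun y => f y - g y) p =
      jumpGrad β cβ pp pm f p - jumpGrad β cβ pp pm g p := by
  unfold jumpGrad; ring

lemma killGrad_sub (f g : ℝ → ℝ) (p : ℝ × ℝ) :
    killGrad β cβ g0 (fun y => f y - g y) p = killGrad β cβ g0 f p - killGrad β cβ g0 g p := by
  unfold killGrad; ring

lemma lintegral_prod_quadrants_le {F : ℝ × ℝ → ENNReal} (hF : Measurable F)
    (h0 : ∀ p : ℝ × ℝ, p.1 * p.2 = 0 → F p = 0) :
    ∫⁻ p, F p ≤ (∫⁻ y in Ioi (0 : ℝ), ∫⁻ y' in Ioi (0 : ℝ), F (y, y'))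
      + (∫⁻ y in Iio (0 : ℝ), ∫⁻ y' in Iio (0 : ℝ), F (y, y'))
      + ∫⁻ y in Ioi (0 : ℝ), ∫⁻ y' in Iio (0 : ℝ), (F (y, y') + F (y', y)) := by
  have hset : ∀ s t : Set ℝ, ∫⁻ p in s ×ˢ t, F p = ∫⁻ y in s, ∫⁻ y' in t, F (y, y') := by
    intro s t
    rw [Measure.volume_eq_prod, ← Measure.prod_restrict, lintegral_prod _ hF.aemeasurable]
  have hset' : ∀ s t : Set ℝ, ∫⁻ p in s ×ˢ t, F p = ∫⁻ y in t, ∫⁻ y' in s, F (y', y) := by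
    intro s t
    rw [Measure.volume_eq_prod, ← Measure.prod_restrict, lintegral_prod_symm' _ hF]
  have hadd : ∫⁻ y in Ioi (0 : ℝ), ∫⁻ y' in Iio (0 : ℝ), (F (y, y') + F (y', y)) =
      (∫⁻ p in Ioi (0 : ℝ) ×ˢ Iio (0 : ℝ), F p) + ∫⁻ p in Iio (0 : ℝ) ×ˢ Ioi (0 : ℝ), F p := by
    rw [hset, hset', ← lintegral_add_left (by fun_prop)]
    congr 1; ext y
    rw [lintegral_add_left (by fun_prop)]
  rw [hadd, ← hset, ← hset, ← setLIntegral_univ]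
  have hzero : ∫⁻ p in {p : ℝ × ℝ | p.1 * p.2 = 0}, F p = 0 := by
    rw [setLIntegral_congr_fun (g := fun _ => 0) (measurableSet_eq_fun (by fun_prop) (by fun_prop))
      (fun p hp => h0 p hp)]
    simp
  have hcover : (univ : Set (ℝ × ℝ)) ⊆ ((Ioi (0 : ℝ) ×ˢ Ioi (0 : ℝ) ∪ Iio (0 : ℝ) ×ˢ Iio (0 : ℝ)) ∪
      (Ioi (0 : ℝ) ×ˢ Iio (0 : ℝ) ∪ Iio (0 : ℝ) ×ˢ Ioi (0 : ℝ))) ∪ {p : ℝ × ℝ | p.1 * p.2 = 0} := by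
    rintro ⟨x, y⟩ -
    rcases lt_trichotomy x 0 with hx | hx | hx <;> rcases lt_trichotomy y 0 with hy | hy | hy <;>
      simp [hx, hy]
  calc ∫⁻ p in univ, F p ≤ _ := lintegral_mono_set hcover
    _ ≤ _ := lintegral_union_le _ _ _
    _ ≤ _ := by
      rw [hzero, add_zero]
      exact (lintegral_union_le _ _ _).trans
        (add_le_add (lintegral_union_le _ _ _) (lintegral_union_le _ _ _))

/-- The Dirichlet energy is controlled by the squared `ℋ₀`-norm. -/
lemma lintegral_energy_le_HnormSq (hβ : 1 < β) (hcβ : 0 < cβ) (hpp : 0 ≤ pp) (hpm : 0 ≤ pm)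
    (hg0 : 0 < g0) (hsum : pp + pm + g0 = 1) (hf : Measurable f) :
    ∫⁻ p, ENNReal.ofReal (jumpGrad β cβ pp pm f p ^ 2 + killGrad β cβ g0 f p ^ 2) ≤
      HnormSq β cβ pp pm g0 f := by
  have hJ := measurable_jumpGrad (β := β) (cβ := cβ) (pp := pp) (pm := pm) hf
  have hK := measurable_killGrad (β := β) (cβ := cβ) (g0 := g0) hf
  have hsq : ∀ p, jumpGrad β cβ pp pm f p ^ 2 + killGrad β cβ g0 f p ^ 2 =
      jumpKernel β cβ pp pm p * (f p.1 - f p.2) ^ 2 + killKernel β cβ g0 p * f p.1 ^ 2 := by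
    intro p
    rw [pow_two, pow_two, jumpGrad_mul hcβ hpp hpm, killGrad_mul hcβ hg0]; ring
  have hsame : ∀ y y' : ℝ, 0 < y * y' →
      ENNReal.ofReal (jumpGrad β cβ pp pm f (y, y') ^ 2 + killGrad β cβ g0 f (y, y') ^ 2) ≤
        ENNReal.ofReal (qbeta β cβ (y - y') * (f y - f y') ^ 2) := by
    intro y y' h
    apply ENNReal.ofReal_le_ofReal
    rw [hsq]
    have hk : killKernel β cβ g0 (y, y') = 0 := by simp [killKernel, h.le]
    rw [hk, zero_mul, add_zero]
    by_cases hy : y = y'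
    · simp [hy]
    · exact mul_le_mul_of_nonneg_right
        (jumpKernel_le hβ hcβ (by linarith) hpm (by linarith) hy) (sq_nonneg _)
  refine (lintegral_prod_quadrants_le (by fun_prop) (fun p hp => ?_)).trans ?_
  · rw [hsq]; simp [jumpKernel, killKernel, hp]
  · unfold HnormSq
    refine add_le_add (add_le_add ?_ ?_) ?_
    · refine setLIntegral_mono' measurableSet_Ioi fun y hy => ?_
      exact setLIntegral_mono' measurableSet_Ioi fun y' hy' => hsame y y' (mul_pos hy hy')
    · refine setLIntegral_mono' measurableSet_Iio fun y hy => ?_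
      exact setLIntegral_mono' measurableSet_Iio fun y' hy' =>
        hsame y y' (mul_pos_of_neg_of_neg hy hy')
    · refine setLIntegral_mono' measurableSet_Ioi fun y hy => ?_
      refine setLIntegral_mono' measurableSet_Iio fun y' hy' => ?_
      rw [← ENNReal.ofReal_add (by positivity) (by positivity)]
      apply ENNReal.ofReal_le_ofReal
      have h1 : y * y' < 0 := mul_neg_of_pos_of_neg hy hy'
      have h2 : y' * y < 0 := by rwa [mul_comm]
      rw [hsq, hsq]
      simp only [jumpKernel, killKernel, h1, h2, h1.not_gt, h2.not_gt, if_true, if_false]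
      rw [qbeta_sub_comm y' y]
      have hq := qbeta_nonneg (β := β) hcβ (y - y')
      have : 0 ≤ qbeta β cβ (y - y') * (pm * (f y - f (-y')) ^ 2) := by positivity
      linarith

lemma memLp_two_of_lintegral_lt_top {Ω : Type*} [MeasurableSpace Ω] {μ : Measure Ω} {u : Ω → ℝ}
    (hu : Measurable u) (h : ∫⁻ x, ENNReal.ofReal (u x ^ 2) ∂μ < ⊤) : MemLp u 2 μ := by
  rw [memLp_two_iff_integrable_sq hu.aestronglyMeasurable]
  exact ⟨(hu.pow_const 2).aestronglyMeasurable,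
    (hasFiniteIntegral_iff_ofReal (Eventually.of_forall fun _ => sq_nonneg _)).2 h⟩

lemma FiniteEnergy.sub {g : ℝ → ℝ} (hf : FiniteEnergy β cβ pp pm g0 f)
    (hg : FiniteEnergy β cβ pp pm g0 g) : FiniteEnergy β cβ pp pm g0 (fun y => f y - g y) := by
  constructor
  · exact (hf.1.sub hg.1).ae_eq (Eventually.of_forall fun p => (jumpGrad_sub f g p).symm)
  · exact (hf.2.sub hg.2).ae_eq (Eventually.of_forall fun p => (killGrad_sub f g p).symm)

lemma memLp_jumpGrad_of_contDiff (hβ : 1 < β) (hcβ : 0 < cβ) (hpp : 0 ≤ pp) (hpm : 0 ≤ pm)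
    (hpp1 : pp ≤ 1) (hpm1 : pm ≤ 1) (hφ : ContDiff ℝ (⊤ : ℕ∞) φ) (hc : HasCompactSupport φ) :
    MemLp (jumpGrad β cβ pp pm φ) 2 (volume : Measure (ℝ × ℝ)) := by
  have hm := measurable_jumpGrad (β := β) (cβ := cβ) (pp := pp) (pm := pm) hφ.continuous.measurable
  rw [memLp_two_iff_integrable_sq hm.aestronglyMeasurable]
  refine (integrable_qbeta_sq_sub hβ hcβ hφ hc).mono' (hm.pow_const 2).aestronglyMeasurable
    (Eventually.of_forall fun p => ?_)
  rw [Real.norm_of_nonneg (sq_nonneg _), pow_two, jumpGrad_mul hcβ hpp hpm, ← pow_two]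
  by_cases hp : p.1 = p.2
  · simp [hp]
  · exact mul_le_mul_of_nonneg_right (jumpKernel_le hβ hcβ hpp1 hpm hpm1 hp) (sq_nonneg _)

lemma IsSpaceTest.exists_forall_abs_lt_eq_zero (hφ : IsSpaceTest φ) :
    ∃ δ, 0 < δ ∧ ∀ y, |y| < δ → φ y = 0 := by
  have h0 : (0 : ℝ) ∈ (tsupport φ)ᶜ := fun h => hφ.2.2 h rfl
  obtain ⟨δ, hδ, hsub⟩ := Metric.isOpen_iff.1 (isClosed_tsupport φ).isOpen_compl 0 h0
  refine ⟨δ, hδ, fun y hy => image_eq_zero_of_notMem_tsupport (hsub ?_)⟩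
  simpa using hy

lemma integrable_crossing (hβ : 1 < β) (hcβ : 0 < cβ) (hφ : IsSpaceTest φ) :
    Integrable (crossing β cβ φ) := by
  obtain ⟨A, hA, hA0⟩ := _root_.exists_forall_abs_lt_eq_zero hφ.2.1
  obtain ⟨δ, hδ, hδ0⟩ := hφ.exists_forall_abs_lt_eq_zero
  obtain ⟨M, hM⟩ := hφ.2.1.exists_bound_of_continuous hφ.1.continuous
  have hM0 : 0 ≤ M := (norm_nonneg _).trans (hM 0)
  have hφm := hφ.1.continuous.measurable
  have hmin : 0 < min 1 (δ ^ 2) := by positivity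
  rw [← integrable_comp_shear]
  refine (integrable_qbeta_snd_mul
    (F := fun p => if p.1 * (p.1 + p.2) < 0 then φ p.1 else 0) (C := M / min 1 (δ ^ 2)) hβ hcβ
    (Measurable.ite (measurableSet_lt (by fun_prop) measurable_const) (by fun_prop)
      measurable_const) hA.le (fun y h => ?_) (fun y h h1 _ _ => ?_)).congr
    (Eventually.of_forall fun p => ?_)
  · have hm' : 0 ≤ min 1 (h ^ 2) := by positivity
    dsimp only
    split_ifs with hyh
    · by_cases hy : |y| < δ
      · rw [hδ0 y hy, abs_zero]; positivity
      · have h1 : δ ^ 2 ≤ h ^ 2 := by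
          have h2 : δ ^ 2 ≤ y ^ 2 := by
            rw [← sq_abs y]; exact pow_le_pow_left₀ hδ.le (not_lt.1 hy) 2
          nlinarith [sq_nonneg (y + h)]
        have h2 : min 1 (δ ^ 2) ≤ min 1 (h ^ 2) := by gcongr
        calc |φ y| ≤ M := hM y
          _ = M / min 1 (δ ^ 2) * min 1 (δ ^ 2) := by field_simp
          _ ≤ _ := by gcongr
    · rw [abs_zero]; positivity
  · simp [hA0 y h1]
  · simp only [crossing, sub_add_cancel_left, qbeta_neg]
    split_ifs <;> simp

lemma IsSpaceTest.finiteEnergy (hβ : 1 < β) (hcβ : 0 < cβ) (hpp : 0 ≤ pp) (hpm : 0 ≤ pm)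
    (hg0 : 0 < g0) (hsum : pp + pm + g0 = 1) (hφ : IsSpaceTest φ) :
    FiniteEnergy β cβ pp pm g0 φ := by
  refine ⟨memLp_jumpGrad_of_contDiff hβ hcβ hpp hpm (by linarith) (by linarith) hφ.1 hφ.2.1, ?_⟩
  obtain ⟨M, hM⟩ := hφ.2.1.exists_bound_of_continuous hφ.1.continuous
  have hφm := hφ.1.continuous.measurable
  rw [memLp_two_iff_integrable_sq (measurable_killGrad hφm).aestronglyMeasurable]
  refine (((integrable_crossing hβ hcβ hφ).mul_bdd (c := M)
    (hφm.comp measurable_fst).aestronglyMeasurable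
    (Eventually.of_forall fun p => hM p.1)).const_mul g0).congr
    (Eventually.of_forall fun p => ?_)
  simp only [pow_two, killGrad_mul hcβ hg0, killKernel, crossing, Function.comp_apply]
  split_ifs <;> ring

end DirichletForm

section FormIdentity

variable {β cβ pp pm g0 : ℝ} {φ V : ℝ → ℝ}

/-- The generator of the interface dynamics tested against `φ ∈ C_c^∞(ℝ \ {0})` is represented by
the Dirichlet form. -/
lemma interfaceForm_eq (hβ : 1 < β) (hcβ : 0 < cβ) (hpp : 0 ≤ pp) (hpm : 0 ≤ pm)
    (hg0 : 0 < g0) (hsum : pp + pm + g0 = 1) (hφ : IsSpaceTest φ)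
    (hV : Measurable V) {M : ℝ} (hVM : ∀ y, |V y| ≤ M) (hVE : FiniteEnergy β cβ pp pm g0 V) :
    interfaceForm β cβ pp pm g0 φ V = (∫ y, pvLambda β cβ φ y * V y) -
      ∫ p, crossing β cβ φ p * (pm * (V (-p.2) - V p.2) - g0 * V p.2) := by
  have hφE := hφ.finiteEnergy hβ hcβ hpp hpm hg0 hsum
  have hφm := hφ.1.continuous.measurable
  have hΦ := integrable_crossing hβ hcβ hφ
  have hmul : ∀ {F : ℝ × ℝ → ℝ} {u : ℝ × ℝ → ℝ}, Integrable F → Measurable u →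
      (∀ p, |u p| ≤ M) → Integrable (fun p => F p * u p) := fun hF hu hb =>
    hF.mul_bdd (c := M) hu.aestronglyMeasurable (Eventually.of_forall hb)
  have hΦ1 : Integrable (fun p : ℝ × ℝ => crossing β cβ φ p * V p.1) :=
    hmul hΦ (by fun_prop) fun p => hVM _
  have hΦ2 : Integrable (fun p : ℝ × ℝ => crossing β cβ φ p * V p.2) :=
    hmul hΦ (by fun_prop) fun p => hVM _
  have hΦ3 : Integrable (fun p : ℝ × ℝ => crossing β cβ φ p * V (-p.2)) :=
    hmul hΦ (by fun_prop) fun p => hVM _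
  have hΔm : Measurable (fun p : ℝ × ℝ => (φ p.1 - φ p.2) * (V p.1 - V p.2)) := by fun_prop
  have hJJ : Integrable (fun p => jumpKernel β cβ pp pm p * ((φ p.1 - φ p.2) * (V p.1 - V p.2))) :=
    (hφE.1.integrable_mul hVE.1).congr (Eventually.of_forall fun p => jumpGrad_mul hcβ hpp hpm φ V p)
  let A1 : ℝ × ℝ → ℝ := fun p => if 0 < p.1 * p.2 then
    (1 / 2) * qbeta β cβ (p.1 - p.2) * ((φ p.1 - φ p.2) * (V p.1 - V p.2)) else 0
  let A2 : ℝ × ℝ → ℝ := fun p => if 0 < p.1 * p.2 then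
    (1 / 2) * (pm * qbeta β cβ (p.1 + p.2)) * ((φ p.1 - φ p.2) * (V p.1 - V p.2)) else 0
  let A3 : ℝ × ℝ → ℝ := fun p => if p.1 * p.2 < 0 then
    qbeta β cβ (p.1 - p.2) * ((φ p.1 - φ p.2) * (V p.1 - V p.2)) else 0
  have hmono : ∀ {a b c : ℝ}, 0 ≤ a → a ≤ b → ‖a * c‖ ≤ ‖b * c‖ := by
    intro a b c ha hab
    rw [norm_mul, norm_mul, Real.norm_of_nonneg ha, Real.norm_of_nonneg (ha.trans hab)]
    exact mul_le_mul_of_nonneg_right hab (norm_nonneg _)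
  have hA1 : Integrable A1 := by
    refine hJJ.mono (Measurable.ite measurableSet_mul_pos (by fun_prop)
      measurable_const).aestronglyMeasurable (Eventually.of_forall fun p => ?_)
    simp only [A1, jumpKernel]
    split_ifs with h
    · have h1 := qbeta_nonneg (β := β) hcβ (p.1 - p.2)
      have h2 := qbeta_nonneg (β := β) hcβ (p.1 + p.2)
      have h3 := mul_nonneg hpm h2
      exact hmono (by positivity) (by linarith)
    · rw [norm_zero]; exact norm_nonneg _
    · rw [norm_zero]; exact norm_nonneg _
  have hA2 : Integrable A2 := by
    refine hJJ.mono (Measurable.ite measurableSet_mul_pos (by fun_prop)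
      measurable_const).aestronglyMeasurable (Eventually.of_forall fun p => ?_)
    simp only [A2, jumpKernel]
    split_ifs with h
    · have h1 := qbeta_nonneg (β := β) hcβ (p.1 - p.2)
      have h2 := qbeta_nonneg (β := β) hcβ (p.1 + p.2)
      have h3 := mul_nonneg hpm h2
      exact hmono (by positivity) (by linarith)
    · rw [norm_zero]; exact norm_nonneg _
    · rw [norm_zero]; exact norm_nonneg _
  have hD : Integrable (fun p : ℝ × ℝ => crossing β cβ φ p * V p.1 - crossing β cβ φ p * V p.2) :=
    hΦ1.sub hΦ2
  have hDs : Integrable (fun p : ℝ × ℝ =>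
      crossing β cβ φ p.swap * V p.swap.1 - crossing β cβ φ p.swap * V p.swap.2) :=
    hD.swap
  have hA3eq : A3 = fun p : ℝ × ℝ => (crossing β cβ φ p * V p.1 - crossing β cβ φ p * V p.2) +
      (crossing β cβ φ p.swap * V p.swap.1 - crossing β cβ φ p.swap * V p.swap.2) := by
    ext p
    simp only [A3, crossing, Prod.fst_swap, Prod.snd_swap, mul_comm p.2 p.1,
      qbeta_sub_comm p.2 p.1]
    split_ifs <;> ring
  have hA3 : Integrable A3 := by rw [hA3eq]; exact hD.add hDs
  have hA3int : ∫ p, A3 p = 2 * ((∫ p, crossing β cβ φ p * V p.1) -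
      ∫ p, crossing β cβ φ p * V p.2) := by
    have e : ∫ p : ℝ × ℝ, (crossing β cβ φ p.swap * V p.swap.1 -
        crossing β cβ φ p.swap * V p.swap.2) =
        ∫ p : ℝ × ℝ, (crossing β cβ φ p * V p.1 - crossing β cβ φ p * V p.2) :=
      integral_prod_swap (μ := (volume : Measure ℝ)) (ν := (volume : Measure ℝ))
        (fun p : ℝ × ℝ => crossing β cβ φ p * V p.1 - crossing β cβ φ p * V p.2)
    rw [hA3eq, integral_add hD hDs, e, integral_sub hΦ1 hΦ2]; ring
  have hrefl : MeasurePreserving (fun p : ℝ × ℝ => (p.1, -p.2)) volume volume :=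
    (MeasurePreserving.id volume).prod (Measure.measurePreserving_neg volume)
  have hreflE : MeasurableEmbedding (fun p : ℝ × ℝ => (p.1, -p.2)) :=
    ((MeasurableEquiv.refl ℝ).prodCongr (MeasurableEquiv.neg ℝ)).measurableEmbedding
  have hR0 : Integrable (fun p : ℝ × ℝ =>
      crossing β cβ φ p * V p.1 - crossing β cβ φ p * V (-p.2)) := hΦ1.sub hΦ3
  have hR : Integrable (fun p : ℝ × ℝ =>
      crossing β cβ φ (p.1, -p.2) * V p.1 - crossing β cβ φ (p.1, -p.2) * V p.2) := by
    have := (hrefl.integrable_comp_emb hreflE).2 hR0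
    simpa [Function.comp_def] using this
  have hRint : ∫ p : ℝ × ℝ,
      (crossing β cβ φ (p.1, -p.2) * V p.1 - crossing β cβ φ (p.1, -p.2) * V p.2) =
      (∫ p, crossing β cβ φ p * V p.1) - ∫ p, crossing β cβ φ p * V (-p.2) := by
    rw [← integral_sub hΦ1 hΦ3, ← hrefl.integral_comp hreflE]
    simp
  have hA2eq : A2 = fun p : ℝ × ℝ => (pm / 2) *
      ((crossing β cβ φ (p.1, -p.2) * V p.1 - crossing β cβ φ (p.1, -p.2) * V p.2) +
      (crossing β cβ φ (p.swap.1, -p.swap.2) * V p.swap.1 -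
        crossing β cβ φ (p.swap.1, -p.swap.2) * V p.swap.2)) := by
    ext p
    simp only [A2, crossing, Prod.fst_swap, Prod.snd_swap, mul_neg, neg_lt_zero, sub_neg_eq_add,
      mul_comm p.2 p.1, add_comm p.2 p.1]
    split_ifs <;> ring
  have hA2int : ∫ p, A2 p = pm * ((∫ p, crossing β cβ φ p * V p.1) -
      ∫ p, crossing β cβ φ p * V (-p.2)) := by
    have e : ∫ p : ℝ × ℝ, (crossing β cβ φ (p.swap.1, -p.swap.2) * V p.swap.1 -
        crossing β cβ φ (p.swap.1, -p.swap.2) * V p.swap.2) = ∫ p : ℝ × ℝ,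
        (crossing β cβ φ (p.1, -p.2) * V p.1 - crossing β cβ φ (p.1, -p.2) * V p.2) :=
      integral_prod_swap (μ := (volume : Measure ℝ)) (ν := (volume : Measure ℝ))
        (fun p : ℝ × ℝ =>
          crossing β cβ φ (p.1, -p.2) * V p.1 - crossing β cβ φ (p.1, -p.2) * V p.2)
    have hRs : Integrable (fun p : ℝ × ℝ => crossing β cβ φ (p.swap.1, -p.swap.2) * V p.swap.1 -
        crossing β cβ φ (p.swap.1, -p.swap.2) * V p.swap.2) := hR.swap
    rw [hA2eq, integral_const_mul, integral_add hR hRs, e, hRint]; ring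
  have hform : interfaceForm β cβ pp pm g0 φ V = (∫ p, A1 p) + (∫ p, A2 p) +
      pp / 2 * (∫ p, A3 p) + g0 * ∫ p, crossing β cβ φ p * V p.1 := by
    have hA12 : Integrable (fun p => A1 p + A2 p) := hA1.add hA2
    unfold interfaceForm
    rw [← integral_const_mul, ← integral_const_mul, ← integral_add hA1 hA2,
      ← integral_add hA12 (hA3.const_mul _)]
    congr 1
    · congr 1; ext p
      rw [jumpGrad_mul hcβ hpp hpm]
      simp only [A1, A2, A3, jumpKernel]
      split_ifs with h1 h2
      · exact absurd h2 h1.not_gt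
      all_goals ring
    · congr 1; ext p
      rw [killGrad_mul hcβ hg0]
      simp only [killKernel, crossing]
      split_ifs <;> ring
  have hfull : (fun p : ℝ × ℝ =>
      qbeta β cβ (p.1 - p.2) * ((φ p.1 - φ p.2) * (V p.1 - V p.2))) =ᵐ[volume]
      fun p => 2 * A1 p + A3 p := by
    have hne : ∀ᵐ x : ℝ, x ≠ 0 := Measure.ae_ne volume 0
    have h1 : ∀ᵐ p : ℝ × ℝ, p.1 ≠ 0 := Measure.quasiMeasurePreserving_fst.ae hne
    have h2 : ∀ᵐ p : ℝ × ℝ, p.2 ≠ 0 := Measure.quasiMeasurePreserving_snd.ae hne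
    filter_upwards [h1, h2] with p hp1 hp2
    simp only [A1, A3]
    rcases (mul_ne_zero hp1 hp2).lt_or_gt with h | h
    · simp [h, h.not_gt]
    · rw [if_pos h, if_neg h.not_gt]; ring
  have hLam : ∫ y, pvLambda β cβ φ y * V y = (∫ p, A1 p) + 1 / 2 * ∫ p, A3 p := by
    rw [integral_pvLambda_mul hβ hcβ hφ.1 hφ.2.1 hV hVM
      (((hA1.const_mul 2).add hA3).congr hfull.symm), integral_congr_ae hfull,
      integral_add (hA1.const_mul 2) hA3, integral_const_mul]
    ring
  have hcross : ∫ p, crossing β cβ φ p * (pm * (V (-p.2) - V p.2) - g0 * V p.2) =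
      pm * ((∫ p, crossing β cβ φ p * V (-p.2)) - ∫ p, crossing β cβ φ p * V p.2) -
        g0 * ∫ p, crossing β cβ φ p * V p.2 := by
    have hΦ32 : Integrable (fun p : ℝ × ℝ =>
        crossing β cβ φ p * V (-p.2) - crossing β cβ φ p * V p.2) := hΦ3.sub hΦ2
    rw [← integral_sub hΦ3 hΦ2, ← integral_const_mul, ← integral_const_mul,
      ← integral_sub (hΦ32.const_mul _) (hΦ2.const_mul _)]
    congr 1; ext p; ring
  rw [hform, hLam, hcross, hA2int, hA3int]
  have hpp' : pp = 1 - pm - g0 := by linarith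
  rw [hpp']
  ring

end FormIdentity

section TimeIntegral

lemma sq_setIntegral_Ioc_le {w : ℝ → ℝ} {s t : ℝ} (hst : s ≤ t)
    (hw : IntegrableOn w (Ioc 0 t)) (hw2 : IntegrableOn (fun r => w r ^ 2) (Ioc 0 t)) :
    (∫ r in Ioc 0 s, w r) ^ 2 ≤ t * ∫ r in Ioc 0 t, w r ^ 2 := by
  rcases le_or_gt s 0 with hs | hs
  · rw [Ioc_eq_empty hs.not_gt]
    rcases le_or_gt t 0 with ht | ht
    · simp [Ioc_eq_empty ht.not_gt]
    · simpa using mul_nonneg ht.le (integral_nonneg fun r => sq_nonneg (w r))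
  have hsub : Ioc 0 s ⊆ Ioc 0 t := Ioc_subset_Ioc_right hst
  have hws := hw.mono_set hsub
  have hw2s := hw2.mono_set hsub
  set v := ∫ r in Ioc 0 s, w r with hv
  have h1 : v ^ 2 ≤ s * ∫ r in Ioc 0 s, w r ^ 2 := by
    have h2 : 0 ≤ ∫ r in Ioc 0 s, (s * w r - v) ^ 2 := integral_nonneg fun r => sq_nonneg _
    have h3 : ∫ r in Ioc 0 s, (s * w r - v) ^ 2 =
        s ^ 2 * (∫ r in Ioc 0 s, w r ^ 2) - 2 * s * v * v + v ^ 2 * s := by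
      have e : ∀ r, (s * w r - v) ^ 2 = (s ^ 2 * w r ^ 2 - 2 * s * v * w r) + v ^ 2 := by
        intro r; ring
      have i1 : IntegrableOn (fun r => s ^ 2 * w r ^ 2 - 2 * s * v * w r) (Ioc 0 s) :=
        (hw2s.const_mul _).sub (hws.const_mul _)
      simp_rw [e]
      rw [integral_add i1 (integrable_const _),
        integral_sub (hw2s.const_mul _) (hws.const_mul _), integral_const_mul,
        integral_const_mul, ← hv]
      simp [hs.le]
      ring
    rw [h3] at h2
    nlinarith
  have h4 : ∫ r in Ioc 0 s, w r ^ 2 ≤ ∫ r in Ioc 0 t, w r ^ 2 :=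
    setIntegral_mono_set hw2 (Eventually.of_forall fun r => sq_nonneg _) hsub.eventuallyLE
  have h5 : 0 ≤ ∫ r in Ioc 0 s, w r ^ 2 := integral_nonneg fun r => sq_nonneg _
  calc v ^ 2 ≤ s * ∫ r in Ioc 0 s, w r ^ 2 := h1
    _ ≤ t * ∫ r in Ioc 0 t, w r ^ 2 := mul_le_mul hst h4 h5 (hs.le.trans hst)

lemma sq_setIntegral_Ioc_eq {w : ℝ → ℝ} {t : ℝ} (hw : IntegrableOn w (Ioc 0 t)) :
    (∫ r in Ioc 0 t, w r) ^ 2 = 2 * ∫ s in Ioc 0 t, w s * ∫ r in Ioc 0 s, w r := by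
  set ν : Measure ℝ := volume.restrict (Ioc 0 t) with hν
  have hww : Integrable (fun p : ℝ × ℝ => w p.1 * w p.2) (ν.prod ν) := Integrable.mul_prod hw hw
  have hD : MeasurableSet {p : ℝ × ℝ | p.2 ≤ p.1} := measurableSet_le (by fun_prop) (by fun_prop)
  set k : ℝ × ℝ → ℝ := {p : ℝ × ℝ | p.2 ≤ p.1}.indicator fun p => w p.1 * w p.2 with hk
  have hki : Integrable k (ν.prod ν) := hww.indicator hD
  have hks : Integrable (fun p => k p.swap) (ν.prod ν) := hki.swap
  have hdiag : ∀ᵐ p ∂(ν.prod ν), p.1 ≠ p.2 := by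
    have hm : MeasurableSet {p : ℝ × ℝ | p.1 ≠ p.2} :=
      (measurableSet_eq_fun measurable_fst measurable_snd).compl
    rw [Measure.ae_prod_iff_ae_ae hm]
    refine Eventually.of_forall fun x => ?_
    filter_upwards [Measure.ae_ne ν x] with y hy using hy.symm
  have hsum : ∫ p, w p.1 * w p.2 ∂(ν.prod ν) = 2 * ∫ p, k p ∂(ν.prod ν) := by
    have e : (fun p : ℝ × ℝ => w p.1 * w p.2) =ᵐ[ν.prod ν] fun p => k p + k p.swap := by
      filter_upwards [hdiag] with p hp
      rcases hp.lt_or_gt with h | h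
      · simp [hk, h.le, h.not_ge, mul_comm]
      · simp [hk, h.le, h.not_ge]
    have e2 : ∫ p : ℝ × ℝ, k p.swap ∂(ν.prod ν) = ∫ p, k p ∂(ν.prod ν) :=
      integral_prod_swap (μ := ν) (ν := ν) k
    rw [integral_congr_ae e, integral_add hki hks, e2]
    ring
  have h1 : ∫ p, w p.1 * w p.2 ∂(ν.prod ν) = (∫ r, w r ∂ν) ^ 2 := by
    rw [integral_prod_mul w w, sq]
  rw [← h1, hsum, integral_prod _ hki]
  congr 1
  refine setIntegral_congr_fun measurableSet_Ioc fun s hs => ?_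
  have e3 : ∀ r, k (s, r) = (Iic s).indicator (fun r => w s * w r) r := fun r => by
    simp [hk, Set.indicator]
  simp only [e3]
  rw [integral_indicator measurableSet_Iic, hν, Measure.restrict_restrict measurableSet_Iic,
    integral_const_mul]
  congr 3
  ext r
  simp only [mem_inter_iff, mem_Iic, mem_Ioc]
  exact ⟨fun h => ⟨h.2.1, h.1⟩, fun h => ⟨h.2, h.1, h.2.trans hs.2⟩⟩

variable {Ω : Type*} [MeasurableSpace Ω] {μ : Measure Ω} [SFinite μ] {w : ℝ → Ω → ℝ} {t : ℝ}

lemma measurable_setIntegral_Ioc (hw : Measurable (Function.uncurry w)) :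
    Measurable (fun p : ℝ × Ω => ∫ r in Ioc 0 p.1, w r p.2) := by
  have e : (fun p : ℝ × Ω => ∫ r in Ioc 0 p.1, w r p.2) = fun p : ℝ × Ω =>
      ∫ r, (if 0 < r ∧ r ≤ p.1 then w r p.2 else 0) := by
    ext p
    rw [← integral_indicator measurableSet_Ioc]
    simp [Set.indicator, mem_Ioc]
  rw [e]
  have h : Measurable (fun q : (ℝ × Ω) × ℝ => if 0 < q.2 ∧ q.2 ≤ q.1.1 then w q.2 q.1.2 else 0) := by
    have h1 : MeasurableSet {q : (ℝ × Ω) × ℝ | 0 < q.2} :=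
      measurableSet_lt measurable_const (by fun_prop)
    have h2 : MeasurableSet {q : (ℝ × Ω) × ℝ | q.2 ≤ q.1.1} :=
      measurableSet_le (by fun_prop) (by fun_prop)
    refine Measurable.ite (h1.inter h2) ?_ measurable_const
    exact hw.comp (by fun_prop : Measurable fun q : (ℝ × Ω) × ℝ => (q.2, q.1.2))
  exact (h.stronglyMeasurable.integral_prod_right (ν := (volume : Measure ℝ))).measurable

lemma integrableOn_Ioc_of_bdd {u : ℝ → ℝ} (hu : Measurable u) {C : ℝ} (hC : ∀ s, |u s| ≤ C) :
    IntegrableOn u (Ioc 0 t) :=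
  Integrable.of_bound hu.aestronglyMeasurable C (Eventually.of_forall hC)

lemma memLp_setIntegral_Ioc (hw : Measurable (Function.uncurry w))
    (hbd : ∀ ω, ∃ C, ∀ s, |w s ω| ≤ C)
    (hE : Integrable (fun p : ℝ × Ω => w p.1 p.2 ^ 2) ((volume.restrict (Ioc 0 t)).prod μ))
    {s : ℝ} (hst : s ≤ t) : MemLp (fun ω => ∫ r in Ioc 0 s, w r ω) 2 μ := by
  have hm : Measurable (fun ω => ∫ r in Ioc 0 s, w r ω) :=
    (measurable_setIntegral_Ioc hw).comp (by fun_prop : Measurable fun ω : Ω => (s, ω))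
  rw [memLp_two_iff_integrable_sq hm.aestronglyMeasurable]
  refine (hE.integral_prod_right.const_mul t).mono (hm.pow_const 2).aestronglyMeasurable
    (Eventually.of_forall fun ω => ?_)
  obtain ⟨C, hC⟩ := hbd ω
  have hwω : Measurable (fun s => w s ω) := hw.comp (by fun_prop : Measurable fun s => (s, ω))
  rw [Real.norm_of_nonneg (sq_nonneg _)]
  refine (sq_setIntegral_Ioc_le hst (integrableOn_Ioc_of_bdd hwω hC)
    (integrableOn_Ioc_of_bdd (hwω.pow_const 2) (C := C ^ 2) fun s => ?_)).trans (le_abs_self _)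
  rw [abs_pow]
  exact pow_le_pow_left₀ (abs_nonneg _) (hC s) 2

lemma integrable_mul_setIntegral_Ioc (hw : Measurable (Function.uncurry w))
    (hbd : ∀ ω, ∃ C, ∀ s, |w s ω| ≤ C)
    (hE : Integrable (fun p : ℝ × Ω => w p.1 p.2 ^ 2) ((volume.restrict (Ioc 0 t)).prod μ)) :
    Integrable (fun p : ℝ × Ω => w p.1 p.2 * ∫ r in Ioc 0 p.1, w r p.2)
      ((volume.restrict (Ioc 0 t)).prod μ) := by
  have hv := measurable_setIntegral_Ioc hw
  have hI : Integrable (fun p : ℝ × Ω => t * ∫ r in Ioc 0 t, w r p.2 ^ 2)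
      ((volume.restrict (Ioc 0 t)).prod μ) :=
    (hE.integral_prod_right.comp_snd _).const_mul t
  refine (hE.add hI).mono (hw.mul hv).aestronglyMeasurable ?_
  have hmem : ∀ᵐ p ∂((volume.restrict (Ioc 0 t)).prod μ), p.1 ∈ Ioc 0 t :=
    Measure.quasiMeasurePreserving_fst.ae (ae_restrict_mem measurableSet_Ioc)
  filter_upwards [hmem] with p hp
  obtain ⟨C, hC⟩ := hbd p.2
  have hwω : Measurable (fun s => w s p.2) := hw.comp (by fun_prop : Measurable fun s => (s, p.2))
  have h1 := sq_setIntegral_Ioc_le hp.2 (integrableOn_Ioc_of_bdd hwω hC)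
    (integrableOn_Ioc_of_bdd (hwω.pow_const 2) (C := C ^ 2) fun s => by
      rw [abs_pow]; exact pow_le_pow_left₀ (abs_nonneg _) (hC s) 2)
  simp only [Pi.add_apply]
  refine le_trans ?_ (le_abs_self _)
  rw [Real.norm_eq_abs, abs_mul]
  have h2 := sq_abs (w p.1 p.2)
  have h3 := sq_abs (∫ r in Ioc 0 p.1, w r p.2)
  nlinarith [two_mul_le_add_sq |w p.1 p.2| |∫ r in Ioc 0 p.1, w r p.2|,
    mul_nonneg (abs_nonneg (w p.1 p.2)) (abs_nonneg (∫ r in Ioc 0 p.1, w r p.2))]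

lemma integral_sq_setIntegral_Ioc (hw : Measurable (Function.uncurry w))
    (hbd : ∀ ω, ∃ C, ∀ s, |w s ω| ≤ C)
    (hE : Integrable (fun p : ℝ × Ω => w p.1 p.2 ^ 2) ((volume.restrict (Ioc 0 t)).prod μ)) :
    ∫ ω, (∫ r in Ioc 0 t, w r ω) ^ 2 ∂μ =
      2 * ∫ s in Ioc 0 t, ∫ ω, w s ω * (∫ r in Ioc 0 s, w r ω) ∂μ := by
  have e : ∀ ω, (∫ r in Ioc 0 t, w r ω) ^ 2 =
      2 * ∫ s in Ioc 0 t, w s ω * ∫ r in Ioc 0 s, w r ω := fun ω => by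
    obtain ⟨C, hC⟩ := hbd ω
    exact sq_setIntegral_Ioc_eq (integrableOn_Ioc_of_bdd
      (hw.comp (by fun_prop : Measurable fun s => (s, ω))) hC)
  simp_rw [e]
  rw [integral_const_mul, ← integral_integral_swap (integrable_mul_setIntegral_Ioc hw hbd hE)]

end TimeIntegral

/-- The Dirichlet energy, with values in `[0,∞]`. -/
def energy (β cβ pp pm g0 : ℝ) (f : ℝ → ℝ) : ENNReal :=
  ∫⁻ p, ENNReal.ofReal (jumpGrad β cβ pp pm f p ^ 2 + killGrad β cβ g0 f p ^ 2)

section Energy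

variable {β cβ pp pm g0 : ℝ} {f g h V χ : ℝ → ℝ}

lemma lintegral_sq_jumpGrad_le_energy :
    ∫⁻ p, ENNReal.ofReal (jumpGrad β cβ pp pm f p ^ 2) ≤ energy β cβ pp pm g0 f :=
  lintegral_mono fun _ => ENNReal.ofReal_le_ofReal (le_add_of_nonneg_right (sq_nonneg _))

lemma lintegral_sq_killGrad_le_energy :
    ∫⁻ p, ENNReal.ofReal (killGrad β cβ g0 f p ^ 2) ≤ energy β cβ pp pm g0 f :=
  lintegral_mono fun _ => ENNReal.ofReal_le_ofReal (le_add_of_nonneg_left (sq_nonneg _))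

lemma finiteEnergy_iff (hf : Measurable f) :
    FiniteEnergy β cβ pp pm g0 f ↔ energy β cβ pp pm g0 f < ⊤ := by
  have hJ := measurable_jumpGrad (β := β) (cβ := cβ) (pp := pp) (pm := pm) hf
  have hK := measurable_killGrad (β := β) (cβ := cβ) (g0 := g0) hf
  constructor
  · intro h
    have h1 := (memLp_two_iff_integrable_sq hJ.aestronglyMeasurable).1 h.1
    have h2 := (memLp_two_iff_integrable_sq hK.aestronglyMeasurable).1 h.2
    exact (hasFiniteIntegral_iff_ofReal (Eventually.of_forall fun _ => by positivity)).1
      (h1.add h2).2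
  · intro h
    exact ⟨memLp_two_of_lintegral_lt_top hJ (lintegral_sq_jumpGrad_le_energy.trans_lt h),
      memLp_two_of_lintegral_lt_top hK (lintegral_sq_killGrad_le_energy.trans_lt h)⟩

lemma enorm_integral_mul_le {Ω : Type*} [MeasurableSpace Ω] {μ : Measure Ω} {a b : Ω → ℝ}
    (ha : AEMeasurable a μ) (hb : AEMeasurable b μ) :
    ‖∫ x, a x * b x ∂μ‖ₑ ≤ (∫⁻ x, ENNReal.ofReal (a x ^ 2) ∂μ) ^ (1 / 2 : ℝ) *
      (∫⁻ x, ENNReal.ofReal (b x ^ 2) ∂μ) ^ (1 / 2 : ℝ) := by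
  have e : ∀ x : ℝ, ENNReal.ofReal (x ^ 2) = ‖x‖ₑ ^ (2 : ℝ) := fun x => by
    rw [Real.enorm_eq_ofReal_abs, ENNReal.ofReal_rpow_of_nonneg (abs_nonneg x) (by norm_num),
      Real.rpow_two, sq_abs]
  simp only [e]
  refine (enorm_integral_le_lintegral_enorm _).trans ?_
  simp only [enorm_mul]
  exact ENNReal.lintegral_mul_le_Lp_mul_Lq μ Real.HolderConjugate.two_two ha.enorm hb.enorm

lemma enorm_interfaceForm_le (hf : Measurable f) (hg : Measurable g) :
    ‖interfaceForm β cβ pp pm g0 f g‖ₑ ≤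
      2 * (energy β cβ pp pm g0 f ^ (1 / 2 : ℝ) * energy β cβ pp pm g0 g ^ (1 / 2 : ℝ)) := by
  refine (enorm_add_le _ _).trans ?_
  rw [two_mul]
  refine add_le_add
    ((enorm_integral_mul_le (measurable_jumpGrad hf).aemeasurable
      (measurable_jumpGrad hg).aemeasurable).trans ?_)
    ((enorm_integral_mul_le (measurable_killGrad hf).aemeasurable
      (measurable_killGrad hg).aemeasurable).trans ?_)
  · gcongr <;> exact lintegral_sq_jumpGrad_le_energy
  · gcongr <;> exact lintegral_sq_killGrad_le_energy

lemma tendsto_interfaceForm_zero {h : ℕ → ℝ → ℝ} (hh : ∀ n, Measurable (h n))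
    (hV : Measurable V) (hVE : FiniteEnergy β cβ pp pm g0 V)
    (hlim : Tendsto (fun n => energy β cβ pp pm g0 (h n)) atTop (𝓝 0)) :
    Tendsto (fun n => interfaceForm β cβ pp pm g0 (h n) V) atTop (𝓝 0) := by
  rw [tendsto_zero_iff_enorm_tendsto_zero]
  refine tendsto_of_tendsto_of_tendsto_of_le_of_le tendsto_const_nhds ?_ (fun n => zero_le)
    (fun n => enorm_interfaceForm_le (hh n) hV)
  have h1 : Tendsto (fun n => energy β cβ pp pm g0 (h n) ^ (1 / 2 : ℝ)) atTop (𝓝 0) := by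
    have := hlim.ennrpow_const (1 / 2 : ℝ)
    rwa [ENNReal.zero_rpow_of_pos (by norm_num)] at this
  have hfin : energy β cβ pp pm g0 V ^ (1 / 2 : ℝ) ≠ ⊤ :=
    (ENNReal.rpow_lt_top_of_nonneg (by norm_num) ((finiteEnergy_iff hV).1 hVE).ne).ne
  have h2 := ENNReal.Tendsto.const_mul (a := 2)
    (ENNReal.Tendsto.mul_const h1 (Or.inr hfin)) (Or.inr (by norm_num))
  simpa using h2

lemma interfaceForm_sub (hf : FiniteEnergy β cβ pp pm g0 f) (hg : FiniteEnergy β cβ pp pm g0 g)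
    (hV : FiniteEnergy β cβ pp pm g0 V) :
    interfaceForm β cβ pp pm g0 (fun y => f y - g y) V =
      interfaceForm β cβ pp pm g0 f V - interfaceForm β cβ pp pm g0 g V := by
  have i1 := hf.1.integrable_mul hV.1
  have i2 := hg.1.integrable_mul hV.1
  have i3 := hf.2.integrable_mul hV.2
  have i4 := hg.2.integrable_mul hV.2
  simp only [Pi.mul_def] at i1 i2 i3 i4
  simp only [interfaceForm, jumpGrad_sub, killGrad_sub, sub_mul]
  rw [integral_sub i1 i2, integral_sub i3 i4]
  ring

lemma ofReal_le_lintegral_killKernel (hβ : 1 < β) (hcβ : 0 < cβ) (hg0 : 0 < g0) {y B : ℝ}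
    (hy : y ≠ 0) (hB : 0 < B) (hyB : |y| ≤ B) :
    ENNReal.ofReal (B * (g0 * qbeta β cβ (2 * B))) ≤
      ∫⁻ y', ENNReal.ofReal (killKernel β cβ g0 (y, y')) := by
  have key : ∀ S : Set ℝ, MeasurableSet S → volume S = ENNReal.ofReal B →
      (∀ y' ∈ S, y * y' < 0 ∧ |y'| ≤ B) →
      ENNReal.ofReal (B * (g0 * qbeta β cβ (2 * B))) ≤
        ∫⁻ y', ENNReal.ofReal (killKernel β cβ g0 (y, y')) := by
    intro S hS hvol hmem
    calc ENNReal.ofReal (B * (g0 * qbeta β cβ (2 * B)))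
        = ∫⁻ _ in S, ENNReal.ofReal (g0 * qbeta β cβ (2 * B)) := by
          rw [setLIntegral_const, hvol, ← ENNReal.ofReal_mul' hB.le, mul_comm]
      _ ≤ ∫⁻ y' in S, ENNReal.ofReal (killKernel β cβ g0 (y, y')) := by
          refine setLIntegral_mono' hS fun y' hy' => ENNReal.ofReal_le_ofReal ?_
          obtain ⟨h1, h2⟩ := hmem y' hy'
          simp only [killKernel, if_pos h1]
          refine mul_le_mul_of_nonneg_left (qbeta_anti hβ hcβ ?_ ?_) hg0.le
          · intro h0
            rw [sub_eq_zero.1 h0] at h1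
            nlinarith [mul_self_nonneg y']
          · rw [abs_of_pos (by positivity : 0 < 2 * B)]
            linarith [abs_sub y y']
      _ ≤ _ := setLIntegral_le_lintegral _ _
  rcases hy.lt_or_gt with h | h
  · refine key (Ioo 0 B) measurableSet_Ioo (by simp) fun y' hy' => ⟨?_, ?_⟩
    · exact mul_neg_of_neg_of_pos h hy'.1
    · rw [abs_of_pos hy'.1]; exact hy'.2.le
  · refine key (Ioo (-B) 0) measurableSet_Ioo (by simp) fun y' hy' => ⟨?_, ?_⟩
    · exact mul_neg_of_pos_of_neg h hy'.2
    · rw [abs_of_neg hy'.2]; linarith [hy'.1]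

lemma exists_lintegral_sq_increment_le (hβ : 1 < β) (hcβ : 0 < cβ) (hg0 : 0 < g0)
    (hχ : ContDiff ℝ (⊤ : ℕ∞) χ) (hc : HasCompactSupport χ) :
    ∃ K : ℝ, 0 ≤ K ∧ ∀ y', y' ≠ 0 →
      ∫⁻ y, ENNReal.ofReal (qbeta β cβ (y - y') * (χ y - χ y') ^ 2) ≤
        ENNReal.ofReal K * ∫⁻ y, ENNReal.ofReal (killKernel β cβ g0 (y', y)) := by
  obtain ⟨A, hA, hA0⟩ := exists_forall_abs_lt_eq_zero hc
  obtain ⟨C, hC, hinc⟩ := exists_sq_increment_le hχ hc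
  have hinc' : ∀ y y', (χ y - χ y') ^ 2 ≤ C * min 1 ((y - y') ^ 2) := fun y y' => by
    simpa using hinc y' (y - y')
  have hqpos : ∀ y : ℝ, 0 < y → 0 < qbeta β cβ y := fun y hy => by
    have := abs_pos.2 hy.ne'
    unfold qbeta; positivity
  have hqi := integrable_qbeta_mul_min (cβ := cβ) hβ
  set I := ∫ h, qbeta β cβ h * min 1 (h ^ 2) with hI
  have hqm0 : ∀ h, 0 ≤ qbeta β cβ h * min 1 (h ^ 2) := fun h =>
    mul_nonneg (qbeta_nonneg hcβ h) (by positivity)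
  have hI0 : 0 ≤ I := integral_nonneg hqm0
  set n0 := (2 * A) * (g0 * qbeta β cβ (2 * (2 * A))) with hn0
  have hn0pos : 0 < n0 := mul_pos (by positivity) (mul_pos hg0 (hqpos _ (by positivity)))
  set K1 := C * I / n0 with hK1
  set K2 := C * 4 ^ (2 + 1 / β) / g0 with hK2
  have hK1' : 0 ≤ K1 := by positivity
  have hK2' : 0 ≤ K2 := by positivity
  refine ⟨K1 + K2, by positivity, fun y' hy' => ?_⟩
  rcases le_or_gt |y'| (2 * A) with hle | hgt
  · calc ∫⁻ y, ENNReal.ofReal (qbeta β cβ (y - y') * (χ y - χ y') ^ 2)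
        ≤ ∫⁻ y, ENNReal.ofReal (C * (qbeta β cβ (y - y') * min 1 ((y - y') ^ 2))) := by
          refine lintegral_mono fun y => ENNReal.ofReal_le_ofReal ?_
          have := mul_le_mul_of_nonneg_left (hinc' y y') (qbeta_nonneg (β := β) hcβ (y - y'))
          linarith
      _ = ∫⁻ h, ENNReal.ofReal (C * (qbeta β cβ h * min 1 (h ^ 2))) :=
          lintegral_sub_right_eq_self
            (fun h => ENNReal.ofReal (C * (qbeta β cβ h * min 1 (h ^ 2)))) y'
      _ = ENNReal.ofReal (C * I) := by
          rw [← ofReal_integral_eq_lintegral_ofReal (hqi.const_mul C)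
            (Eventually.of_forall fun h => mul_nonneg hC (hqm0 h)), integral_const_mul]
      _ = ENNReal.ofReal K1 * ENNReal.ofReal n0 := by
          rw [← ENNReal.ofReal_mul hK1', hK1, div_mul_cancel₀ _ hn0pos.ne']
      _ ≤ ENNReal.ofReal (K1 + K2) * ∫⁻ y, ENNReal.ofReal (killKernel β cβ g0 (y', y)) := by
          gcongr
          · linarith
          · exact ofReal_le_lintegral_killKernel hβ hcβ hg0 hy' (by positivity) hle
  · have hy0 : 0 < |y'| := abs_pos.2 hy'
    have hχ0 : χ y' = 0 := hA0 y' (by linarith)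
    have hq0 := qbeta_nonneg (β := β) hcβ (|y'| / 2)
    have hscale : qbeta β cβ (2 * |y'|) = (4 ^ (2 + 1 / β))⁻¹ * qbeta β cβ (|y'| / 2) := by
      rw [← qbeta_mul 4 (by norm_num)]; congr 1; ring
    calc ∫⁻ y, ENNReal.ofReal (qbeta β cβ (y - y') * (χ y - χ y') ^ 2)
        ≤ ∫⁻ y, (Icc (-A) A).indicator
            (fun _ => ENNReal.ofReal (qbeta β cβ (|y'| / 2) * C)) y := by
          refine lintegral_mono fun y => ?_
          by_cases hy : y ∈ Icc (-A) A
          · rw [indicator_of_mem hy]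
            refine ENNReal.ofReal_le_ofReal ?_
            have hyA : |y| ≤ A := abs_le.2 hy
            have h1 : qbeta β cβ (y - y') ≤ qbeta β cβ (|y'| / 2) := by
              refine qbeta_anti hβ hcβ (by positivity) ?_
              rw [abs_of_pos (by positivity : 0 < |y'| / 2), abs_sub_comm]
              linarith [abs_sub_abs_le_abs_sub y' y]
            have h2 : (χ y - χ y') ^ 2 ≤ C :=
              (hinc' y y').trans (mul_le_of_le_one_right hC (min_le_left _ _))
            exact mul_le_mul h1 h2 (sq_nonneg _) hq0
          · have hy0 : χ y = 0 := by
              refine hA0 y ?_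
              by_contra hcon
              exact hy (abs_le.1 (not_lt.1 hcon))
            simp [hy0, hχ0]
      _ = ENNReal.ofReal (qbeta β cβ (|y'| / 2) * C * (2 * A)) := by
          rw [lintegral_indicator_const measurableSet_Icc, Real.volume_Icc,
            ← ENNReal.ofReal_mul (by positivity)]
          congr 1; ring
      _ ≤ ENNReal.ofReal (K2 * (|y'| * (g0 * qbeta β cβ (2 * |y'|)))) := by
          refine ENNReal.ofReal_le_ofReal ?_
          have : K2 * (|y'| * (g0 * qbeta β cβ (2 * |y'|))) =
              qbeta β cβ (|y'| / 2) * C * |y'| := by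
            rw [hscale, hK2]
            have : (4 : ℝ) ^ (2 + 1 / β) ≠ 0 := by positivity
            field_simp
          rw [this]
          gcongr
      _ ≤ ENNReal.ofReal (K1 + K2) * ∫⁻ y, ENNReal.ofReal (killKernel β cβ g0 (y', y)) := by
          rw [ENNReal.ofReal_mul hK2']
          gcongr
          · linarith
          · exact ofReal_le_lintegral_killKernel hβ hcβ hg0 hy' hy0 le_rfl

/-- Multiplication by a cutoff is bounded in energy, thanks to the killing at the interface. -/
lemma exists_energy_mul_le (hβ : 1 < β) (hcβ : 0 < cβ) (hpp : 0 ≤ pp) (hpm : 0 ≤ pm)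
    (hpp1 : pp ≤ 1) (hpm1 : pm ≤ 1) (hg0 : 0 < g0)
    (hχ : ContDiff ℝ (⊤ : ℕ∞) χ) (hc : HasCompactSupport χ) (hχ1 : ∀ y, |χ y| ≤ 1) :
    ∃ K : ℝ, 0 ≤ K ∧ ∀ g, Measurable g →
      energy β cβ pp pm g0 (fun y => χ y * g y) ≤ ENNReal.ofReal K * energy β cβ pp pm g0 g := by
  obtain ⟨K, hK, hle⟩ := exists_lintegral_sq_increment_le hβ hcβ hg0 hχ hc
  have hχm := hχ.continuous.measurable
  refine ⟨2 + 2 * K, by positivity, fun g hg => ?_⟩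
  have hJ := measurable_jumpGrad (β := β) (cβ := cβ) (pp := pp) (pm := pm) hg
  have hKm := measurable_killGrad (β := β) (cβ := cβ) (g0 := g0) hg
  have hpt : ∀ p : ℝ × ℝ, jumpGrad β cβ pp pm (fun y => χ y * g y) p ^ 2 +
      killGrad β cβ g0 (fun y => χ y * g y) p ^ 2 ≤
      2 * (jumpGrad β cβ pp pm g p ^ 2 + killGrad β cβ g0 g p ^ 2) +
        2 * (g p.2 ^ 2 * (qbeta β cβ (p.1 - p.2) * (χ p.1 - χ p.2) ^ 2)) := by
    intro p
    have hs1 := Real.sq_sqrt (jumpKernel_nonneg (β := β) hcβ hpp hpm p)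
    have h1 : jumpGrad β cβ pp pm (fun y => χ y * g y) p =
        χ p.1 * jumpGrad β cβ pp pm g p +
          √(jumpKernel β cβ pp pm p) * (g p.2 * (χ p.1 - χ p.2)) := by
      unfold jumpGrad; ring
    have h2 : killGrad β cβ g0 (fun y => χ y * g y) p = χ p.1 * killGrad β cβ g0 g p := by
      unfold killGrad; ring
    have h3 : χ p.1 ^ 2 ≤ 1 := by
      rw [← sq_abs]; exact pow_le_one₀ (abs_nonneg _) (hχ1 _)
    have h4 : jumpKernel β cβ pp pm p * (χ p.1 - χ p.2) ^ 2 ≤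
        qbeta β cβ (p.1 - p.2) * (χ p.1 - χ p.2) ^ 2 := by
      by_cases hp : p.1 = p.2
      · simp [hp]
      · exact mul_le_mul_of_nonneg_right (jumpKernel_le hβ hcβ hpp1 hpm hpm1 hp) (sq_nonneg _)
    have h5 := mul_le_mul_of_nonneg_left h4 (sq_nonneg (g p.2))
    have h6 := mul_le_mul_of_nonneg_right h3 (sq_nonneg (jumpGrad β cβ pp pm g p))
    have h7 := mul_le_mul_of_nonneg_right h3 (sq_nonneg (killGrad β cβ g0 g p))
    have h8 : (√(jumpKernel β cβ pp pm p) * (g p.2 * (χ p.1 - χ p.2))) ^ 2 =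
        g p.2 ^ 2 * (jumpKernel β cβ pp pm p * (χ p.1 - χ p.2) ^ 2) := by
      rw [mul_pow, hs1]; ring
    rw [h1, h2]
    nlinarith [add_sq_le (a := χ p.1 * jumpGrad β cβ pp pm g p)
      (b := √(jumpKernel β cβ pp pm p) * (g p.2 * (χ p.1 - χ p.2))),
      sq_nonneg (killGrad β cβ g0 g p)]
  have hkill : ∫⁻ p : ℝ × ℝ, ENNReal.ofReal
      (2 * (g p.2 ^ 2 * (qbeta β cβ (p.1 - p.2) * (χ p.1 - χ p.2) ^ 2))) ≤
      ENNReal.ofReal (2 * K) * energy β cβ pp pm g0 g := by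
    have hne : ∀ᵐ x : ℝ, x ≠ 0 := Measure.ae_ne volume 0
    calc ∫⁻ p : ℝ × ℝ, ENNReal.ofReal
          (2 * (g p.2 ^ 2 * (qbeta β cβ (p.1 - p.2) * (χ p.1 - χ p.2) ^ 2)))
        = ∫⁻ y', ∫⁻ y, ENNReal.ofReal
          (2 * (g y' ^ 2 * (qbeta β cβ (y - y') * (χ y - χ y') ^ 2))) :=
          lintegral_prod_symm' _ (by fun_prop)
      _ ≤ ∫⁻ y', ∫⁻ y, ENNReal.ofReal (2 * K) *
            ENNReal.ofReal (killGrad β cβ g0 g (y', y) ^ 2) := by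
          refine lintegral_mono_ae (hne.mono fun y' hy' => ?_)
          have e1 : ∀ y, ENNReal.ofReal
              (2 * (g y' ^ 2 * (qbeta β cβ (y - y') * (χ y - χ y') ^ 2))) =
              ENNReal.ofReal (2 * g y' ^ 2) *
                ENNReal.ofReal (qbeta β cβ (y - y') * (χ y - χ y') ^ 2) := fun y => by
            rw [← ENNReal.ofReal_mul (by positivity), mul_assoc]
          have e2 : ∀ y, ENNReal.ofReal (2 * K) *
              ENNReal.ofReal (killGrad β cβ g0 g (y', y) ^ 2) =
              ENNReal.ofReal (2 * g y' ^ 2) *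
                (ENNReal.ofReal K * ENNReal.ofReal (killKernel β cβ g0 (y', y))) := fun y => by
            rw [sq (killGrad β cβ g0 g (y', y)), killGrad_mul hcβ hg0,
              ← ENNReal.ofReal_mul hK, ← ENNReal.ofReal_mul (by positivity),
              ← ENNReal.ofReal_mul (by positivity)]
            congr 1; ring
          simp only [e1, e2]
          rw [lintegral_const_mul' _ _ ENNReal.ofReal_ne_top,
            lintegral_const_mul' _ _ ENNReal.ofReal_ne_top,
            lintegral_const_mul' _ _ ENNReal.ofReal_ne_top]
          gcongr
          exact hle y' hy'
      _ = ENNReal.ofReal (2 * K) * ∫⁻ p, ENNReal.ofReal (killGrad β cβ g0 g p ^ 2) := by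
          rw [Measure.volume_eq_prod, lintegral_prod _ (by fun_prop),
            ← lintegral_const_mul' _ _ ENNReal.ofReal_ne_top]
          simp only [lintegral_const_mul' _ _ ENNReal.ofReal_ne_top]
      _ ≤ _ := by gcongr; exact lintegral_sq_killGrad_le_energy
  calc energy β cβ pp pm g0 (fun y => χ y * g y)
      ≤ ∫⁻ p : ℝ × ℝ, (ENNReal.ofReal 2 * ENNReal.ofReal
          (jumpGrad β cβ pp pm g p ^ 2 + killGrad β cβ g0 g p ^ 2) + ENNReal.ofReal
          (2 * (g p.2 ^ 2 * (qbeta β cβ (p.1 - p.2) * (χ p.1 - χ p.2) ^ 2)))) := by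
        refine lintegral_mono fun p => ?_
        have hq := qbeta_nonneg (β := β) hcβ (p.1 - p.2)
        rw [← ENNReal.ofReal_mul (by norm_num), ← ENNReal.ofReal_add (by positivity)
          (by positivity)]
        exact ENNReal.ofReal_le_ofReal (hpt p)
    _ ≤ ENNReal.ofReal (2 + 2 * K) * energy β cβ pp pm g0 g := by
        rw [lintegral_add_right _ (by fun_prop),
          lintegral_const_mul' _ _ ENNReal.ofReal_ne_top,
          ENNReal.ofReal_add (by norm_num) (by positivity), add_mul]
        exact add_le_add le_rfl hkill

end Energy

section Cutoff

variable {β cβ pp pm g0 : ℝ} {f g V χ : ℝ → ℝ}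

/-- A smooth cutoff equal to `1` on `[-1, 1]`. -/
def spaceCutoff : ContDiffBump (0 : ℝ) := ⟨1, 2, one_pos, one_lt_two⟩

/-- The cutoff at scale `n + 1`. -/
def cutoffAt (n : ℕ) (y : ℝ) : ℝ := spaceCutoff (((n : ℝ) + 1)⁻¹ * y)

lemma contDiff_cutoffAt (n : ℕ) : ContDiff ℝ (⊤ : ℕ∞) (cutoffAt n) :=
  spaceCutoff.contDiff.comp (by fun_prop)

lemma hasCompactSupport_cutoffAt (n : ℕ) : HasCompactSupport (cutoffAt n) := by
  have h := spaceCutoff.hasCompactSupport.comp_homeomorph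
    (Homeomorph.mulLeft₀ ((n : ℝ) + 1)⁻¹ (by positivity))
  exact h

lemma cutoffAt_nonneg (n : ℕ) (y : ℝ) : 0 ≤ cutoffAt n y := spaceCutoff.nonneg

lemma cutoffAt_le_one (n : ℕ) (y : ℝ) : cutoffAt n y ≤ 1 := spaceCutoff.le_one

lemma eventually_cutoffAt_eq_one (y : ℝ) : ∀ᶠ n in atTop, cutoffAt n y = 1 := by
  filter_upwards [eventually_ge_atTop ⌈|y|⌉₊] with n hn
  refine spaceCutoff.one_of_mem_closedBall ?_
  have h1 : |y| ≤ n := (Nat.le_ceil _).trans (by exact_mod_cast hn)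
  have h2 : (0 : ℝ) < n + 1 := by positivity
  simp only [Metric.mem_closedBall, dist_zero_right, norm_mul, Real.norm_eq_abs, abs_inv,
    abs_of_pos h2]
  change _ ≤ (1 : ℝ)
  rw [inv_mul_le_one₀ h2]
  linarith

lemma lintegral_sq_increment_cutoffAt (hβ : 1 < β) (hcβ : 0 < cβ) (n : ℕ) :
    ∫⁻ p : ℝ × ℝ, ENNReal.ofReal
      (qbeta β cβ (p.1 - p.2) * (cutoffAt n p.1 - cutoffAt n p.2) ^ 2) =
      ENNReal.ofReal (((n : ℝ) + 1) ^ (-(1 / β)) * ∫ p : ℝ × ℝ,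
        qbeta β cβ (p.1 - p.2) * (spaceCutoff p.1 - spaceCutoff p.2) ^ 2) := by
  have hR : (0 : ℝ) < (n : ℝ) + 1 := by positivity
  rw [← ofReal_integral_eq_lintegral_ofReal
    (integrable_qbeta_sq_sub hβ hcβ (contDiff_cutoffAt n) (hasCompactSupport_cutoffAt n))
    (Eventually.of_forall fun p => mul_nonneg (qbeta_nonneg hcβ _) (sq_nonneg _))]
  congr 1
  obtain ⟨ψ, hψ⟩ : ∃ ψ : ℝ × ℝ → ℝ, ψ = fun p : ℝ × ℝ =>
      qbeta β cβ (p.1 - p.2) * (spaceCutoff p.1 - spaceCutoff p.2) ^ 2 := ⟨_, rfl⟩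
  have e : ∀ p : ℝ × ℝ,
      qbeta β cβ (p.1 - p.2) * (cutoffAt n p.1 - cutoffAt n p.2) ^ 2 =
      (((n : ℝ) + 1) ^ (2 + 1 / β))⁻¹ * ψ ((((n : ℝ) + 1)⁻¹) • p) := by
    intro p
    simp only [hψ]
    simp only [Prod.smul_fst, Prod.smul_snd, smul_eq_mul, cutoffAt, ← mul_sub]
    rw [← mul_assoc, ← qbeta_mul _ hR, ← mul_assoc, mul_inv_cancel₀ hR.ne', one_mul]
  simp_rw [e]
  rw [← hψ, integral_const_mul, Measure.integral_comp_smul]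
  simp only [Module.finrank_prod, Module.finrank_self, smul_eq_mul]
  rw [← mul_assoc]
  congr 1
  rw [inv_pow, inv_inv, abs_of_pos (by positivity), Real.rpow_add hR, Real.rpow_neg hR.le,
    mul_inv]
  norm_num
  field_simp

lemma tendsto_lintegral_sq_increment_cutoffAt (hβ : 1 < β) (hcβ : 0 < cβ) :
    Tendsto (fun n => ∫⁻ p : ℝ × ℝ, ENNReal.ofReal
      (qbeta β cβ (p.1 - p.2) * (cutoffAt n p.1 - cutoffAt n p.2) ^ 2)) atTop (𝓝 0) := by
  simp only [lintegral_sq_increment_cutoffAt hβ hcβ]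
  have h1 : Tendsto (fun n : ℕ => ((n : ℝ) + 1) ^ (-(1 / β))) atTop (𝓝 0) :=
    (tendsto_rpow_neg_atTop (by positivity)).comp
      (tendsto_atTop_add_const_right _ _ tendsto_natCast_atTop_atTop)
  have h2 := ENNReal.tendsto_ofReal (h1.mul_const (∫ p : ℝ × ℝ,
        qbeta β cβ (p.1 - p.2) * (spaceCutoff p.1 - spaceCutoff p.2) ^ 2))
  simpa using h2

lemma tendsto_energy_sub_cutoffAt_mul (hβ : 1 < β) (hcβ : 0 < cβ) (hpp : 0 ≤ pp) (hpm : 0 ≤ pm)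
    (hpp1 : pp ≤ 1) (hpm1 : pm ≤ 1) (hf : Measurable f) {M : ℝ} (hfM : ∀ y, |f y| ≤ M)
    (hfE : FiniteEnergy β cβ pp pm g0 f) :
    Tendsto (fun n => energy β cβ pp pm g0 (fun y => f y - cutoffAt n y * f y))
      atTop (𝓝 0) := by
  have hJ := measurable_jumpGrad (β := β) (cβ := cβ) (pp := pp) (pm := pm) hf
  have hK := measurable_killGrad (β := β) (cβ := cβ) (g0 := g0) hf
  have hχm : ∀ n, Measurable (cutoffAt n) := fun n => (contDiff_cutoffAt n).continuous.measurable
  let F : ℕ → ℝ × ℝ → ENNReal := fun n p => ENNReal.ofReal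
    (2 * (1 - cutoffAt n p.1) ^ 2 *
      (jumpGrad β cβ pp pm f p ^ 2 + killGrad β cβ g0 f p ^ 2))
  have hF : Tendsto (fun n => ∫⁻ p, F n p) atTop (𝓝 0) := by
    have hlim : Tendsto (fun n => ∫⁻ p, F n p) atTop (𝓝 (∫⁻ _ : ℝ × ℝ, 0)) := by
      refine tendsto_lintegral_of_dominated_convergence
        (fun p => 2 * ENNReal.ofReal (jumpGrad β cβ pp pm f p ^ 2 + killGrad β cβ g0 f p ^ 2))
        (fun n => by have := hχm n; fun_prop) (fun n => Eventually.of_forall fun p => ?_) ?_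
        (Eventually.of_forall fun p => ?_)
      · dsimp only [F]
        rw [← ENNReal.ofReal_ofNat, ← ENNReal.ofReal_mul (by norm_num)]
        refine ENNReal.ofReal_le_ofReal (mul_le_mul_of_nonneg_right ?_ (by positivity))
        have h1 := cutoffAt_nonneg n p.1
        have h2 := cutoffAt_le_one n p.1
        nlinarith
      · rw [lintegral_const_mul' _ _ (by norm_num)]
        exact ENNReal.mul_ne_top (by norm_num) ((finiteEnergy_iff hf).1 hfE).ne
      · refine tendsto_const_nhds.congr' ?_
        filter_upwards [eventually_cutoffAt_eq_one p.1] with n hn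
        simp [F, hn]
    simpa using hlim
  have hG := ENNReal.Tendsto.const_mul (a := ENNReal.ofReal (2 * M ^ 2))
    (tendsto_lintegral_sq_increment_cutoffAt (β := β) (cβ := cβ) hβ hcβ)
    (Or.inr ENNReal.ofReal_ne_top)
  have hFG := hF.add hG
  rw [mul_zero, add_zero] at hFG
  refine tendsto_of_tendsto_of_tendsto_of_le_of_le tendsto_const_nhds hFG (fun n => zero_le)
    fun n => ?_
  have hn := hχm n
  dsimp only
  rw [← lintegral_const_mul' _ _ ENNReal.ofReal_ne_top, ← lintegral_add_right _ (by fun_prop)]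
  refine lintegral_mono fun p => ?_
  have hq := qbeta_nonneg (β := β) hcβ (p.1 - p.2)
  rw [← ENNReal.ofReal_mul (by positivity), ← ENNReal.ofReal_add (by positivity) (by positivity)]
  refine ENNReal.ofReal_le_ofReal ?_
  have hs1 := Real.sq_sqrt (jumpKernel_nonneg (β := β) hcβ hpp hpm p)
  have h1 : jumpGrad β cβ pp pm (fun y => f y - cutoffAt n y * f y) p =
      (1 - cutoffAt n p.1) * jumpGrad β cβ pp pm f p -
        √(jumpKernel β cβ pp pm p) * (f p.2 * (cutoffAt n p.1 - cutoffAt n p.2)) := by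
    unfold jumpGrad; ring
  have h2 : killGrad β cβ g0 (fun y => f y - cutoffAt n y * f y) p =
      (1 - cutoffAt n p.1) * killGrad β cβ g0 f p := by
    unfold killGrad; ring
  have h4 : jumpKernel β cβ pp pm p * (cutoffAt n p.1 - cutoffAt n p.2) ^ 2 ≤
      qbeta β cβ (p.1 - p.2) * (cutoffAt n p.1 - cutoffAt n p.2) ^ 2 := by
    by_cases hp : p.1 = p.2
    · simp [hp]
    · exact mul_le_mul_of_nonneg_right (jumpKernel_le hβ hcβ hpp1 hpm hpm1 hp) (sq_nonneg _)
  have h8 : (√(jumpKernel β cβ pp pm p) * (f p.2 * (cutoffAt n p.1 - cutoffAt n p.2))) ^ 2 =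
      f p.2 ^ 2 * (jumpKernel β cβ pp pm p * (cutoffAt n p.1 - cutoffAt n p.2) ^ 2) := by
    rw [mul_pow, hs1]; ring
  have h9 : f p.2 ^ 2 ≤ M ^ 2 := by
    rw [← sq_abs]; exact pow_le_pow_left₀ (abs_nonneg _) (hfM _) 2
  have h10 : f p.2 ^ 2 * (jumpKernel β cβ pp pm p * (cutoffAt n p.1 - cutoffAt n p.2) ^ 2) ≤
      M ^ 2 * (qbeta β cβ (p.1 - p.2) * (cutoffAt n p.1 - cutoffAt n p.2) ^ 2) :=
    mul_le_mul h9 h4 (mul_nonneg (jumpKernel_nonneg hcβ hpp hpm p) (sq_nonneg _)) (sq_nonneg _)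
  rw [h1, h2]
  nlinarith [sq_nonneg ((1 - cutoffAt n p.1) * jumpGrad β cβ pp pm f p +
      √(jumpKernel β cβ pp pm p) * (f p.2 * (cutoffAt n p.1 - cutoffAt n p.2))),
    sq_nonneg ((1 - cutoffAt n p.1) * killGrad β cβ g0 f p)]

lemma IsSpaceTest.cutoff_mul {φ : ℝ → ℝ} (hχ : ContDiff ℝ (⊤ : ℕ∞) χ) (hφ : IsSpaceTest φ) :
    IsSpaceTest (fun y => χ y * φ y) :=
  ⟨hχ.mul hφ.1, hφ.2.1.mul_left, (tsupport_mul_subset_right (f := χ) (g := φ)).trans hφ.2.2⟩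

lemma exists_lintegral_cutoff_mul_sq_le (hβ : 1 < β) (hcβ : 0 < cβ) (hg0 : 0 < g0)
    (hχc : HasCompactSupport χ) (hχ1 : ∀ y, χ y ≤ 1) :
    ∃ K : ℝ, ∀ g, Measurable g → ∫⁻ y, ENNReal.ofReal (χ y * g y ^ 2) ≤
      ENNReal.ofReal K * energy β cβ pp pm g0 g := by
  obtain ⟨B, hB, hB0⟩ := exists_forall_abs_lt_eq_zero hχc
  set n0 := B * (g0 * qbeta β cβ (2 * B)) with hn0
  have hn0pos : 0 < n0 := by
    have : 0 < |2 * B| := by positivity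
    have : 0 < qbeta β cβ (2 * B) := by unfold qbeta; positivity
    positivity
  have hinv : (0 : ℝ) ≤ n0⁻¹ := (inv_pos.2 hn0pos).le
  refine ⟨n0⁻¹, fun g hg => ?_⟩
  have hKm := measurable_killGrad (β := β) (cβ := cβ) (g0 := g0) hg
  have hne : ∀ᵐ x : ℝ, x ≠ 0 := Measure.ae_ne volume 0
  calc ∫⁻ y, ENNReal.ofReal (χ y * g y ^ 2)
      ≤ ∫⁻ y, ENNReal.ofReal n0⁻¹ * ∫⁻ y', ENNReal.ofReal (killGrad β cβ g0 g (y, y') ^ 2) := by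
        refine lintegral_mono_ae (hne.mono fun y hy => ?_)
        rcases le_or_gt |y| B with hyB | hyB
        · have e : ∀ y', ENNReal.ofReal (killGrad β cβ g0 g (y, y') ^ 2) =
              ENNReal.ofReal (g y ^ 2) * ENNReal.ofReal (killKernel β cβ g0 (y, y')) :=
            fun y' => by
              rw [sq (killGrad β cβ g0 g (y, y')), killGrad_mul hcβ hg0,
                ← ENNReal.ofReal_mul (by positivity)]
              congr 1; ring
          simp only [e]
          rw [lintegral_const_mul' _ _ ENNReal.ofReal_ne_top]
          calc ENNReal.ofReal (χ y * g y ^ 2) ≤ ENNReal.ofReal (n0⁻¹ * (g y ^ 2 * n0)) := by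
                refine ENNReal.ofReal_le_ofReal ?_
                have : n0⁻¹ * (g y ^ 2 * n0) = g y ^ 2 := by field_simp
                rw [this]
                exact mul_le_of_le_one_left (sq_nonneg _) (hχ1 y)
            _ = ENNReal.ofReal n0⁻¹ * (ENNReal.ofReal (g y ^ 2) * ENNReal.ofReal n0) := by
                rw [ENNReal.ofReal_mul hinv, ENNReal.ofReal_mul (sq_nonneg _)]
            _ ≤ _ := by
                gcongr
                exact ofReal_le_lintegral_killKernel hβ hcβ hg0 hy hB hyB
        · simp [hB0 y hyB]
    _ = ENNReal.ofReal n0⁻¹ * ∫⁻ p, ENNReal.ofReal (killGrad β cβ g0 g p ^ 2) := by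
        rw [Measure.volume_eq_prod, lintegral_prod _ (by fun_prop),
          lintegral_const_mul' _ _ ENNReal.ofReal_ne_top]
    _ ≤ _ := by gcongr; exact lintegral_sq_killGrad_le_energy

/-- If `f` is bounded, lies in the energy closure of `C_c^∞(ℝ \ {0})` and `f = -c L V` weakly, then
the form of `f` and `V` is nonpositive. -/
lemma interfaceForm_nonpos (hβ : 1 < β) (hcβ : 0 < cβ) (hpp : 0 ≤ pp) (hpm : 0 ≤ pm)
    (hg0 : 0 < g0) (hsum : pp + pm + g0 = 1) (hf : Measurable f) {M : ℝ}
    (hfM : ∀ y, |f y| ≤ M) (hfE : FiniteEnergy β cβ pp pm g0 f) (hV : Measurable V)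
    (hVE : FiniteEnergy β cβ pp pm g0 V) {φ : ℕ → ℝ → ℝ} (hφ : ∀ n, IsSpaceTest (φ n))
    (hlim : Tendsto (fun n => energy β cβ pp pm g0 (fun y => f y - φ n y)) atTop (𝓝 0))
    {c : ℝ} (hc : 0 < c)
    (hweak : ∀ ψ, IsSpaceTest ψ → ∫ y, ψ y * f y = -(c * interfaceForm β cβ pp pm g0 ψ V)) :
    interfaceForm β cβ pp pm g0 f V ≤ 0 := by
  have hpp1 : pp ≤ 1 := by linarith
  have hpm1 : pm ≤ 1 := by linarith
  have hφm : ∀ n, Measurable (φ n) := fun n => (hφ n).1.continuous.measurable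
  have hcut : ∀ N, FiniteEnergy β cβ pp pm g0 (fun y => cutoffAt N y * f y) ∧
      interfaceForm β cβ pp pm g0 (fun y => cutoffAt N y * f y) V ≤ 0 := by
    intro N
    have hχ := contDiff_cutoffAt N
    have hχm := hχ.continuous.measurable
    have hχc := hasCompactSupport_cutoffAt N
    have hχ0 := cutoffAt_nonneg N
    have hχ1 := cutoffAt_le_one N
    obtain ⟨K, hK, hle⟩ := exists_energy_mul_le hβ hcβ hpp hpm hpp1 hpm1 hg0 hχ hχc
      fun y => abs_le.2 ⟨by linarith [hχ0 y], hχ1 y⟩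
    obtain ⟨K', hle'⟩ := exists_lintegral_cutoff_mul_sq_le (pp := pp) (pm := pm) hβ hcβ hg0 hχc hχ1
    have hχfm : Measurable fun y => cutoffAt N y * f y := hχm.mul hf
    have hχfE : FiniteEnergy β cβ pp pm g0 (fun y => cutoffAt N y * f y) :=
      (finiteEnergy_iff hχfm).2 ((hle f hf).trans_lt
        (ENNReal.mul_lt_top ENNReal.ofReal_lt_top ((finiteEnergy_iff hf).1 hfE)))
    refine ⟨hχfE, ?_⟩
    have htest : ∀ n, IsSpaceTest (fun y => cutoffAt N y * φ n y) := fun n => (hφ n).cutoff_mul hχ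
    have htE := fun n => (htest n).finiteEnergy hβ hcβ hpp hpm hg0 hsum
    have hKlim : ∀ K : ℝ, Tendsto (fun n => ENNReal.ofReal K *
        energy β cβ pp pm g0 (fun y => f y - φ n y)) atTop (𝓝 0) := fun K => by
      simpa using ENNReal.Tendsto.const_mul hlim (Or.inr (ENNReal.ofReal_ne_top (r := K)))
    have h1 : Tendsto (fun n => interfaceForm β cβ pp pm g0
        (fun y => cutoffAt N y * (f y - φ n y)) V) atTop (𝓝 0) := by
      refine tendsto_interfaceForm_zero (fun n => hχm.mul (hf.sub (hφm n))) hV hVE ?_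
      exact tendsto_of_tendsto_of_tendsto_of_le_of_le tendsto_const_nhds (hKlim K)
        (fun n => zero_le) (fun n => hle _ (hf.sub (hφm n)))
    have h2 : ∀ n, interfaceForm β cβ pp pm g0 (fun y => cutoffAt N y * f y) V ≤
        interfaceForm β cβ pp pm g0 (fun y => cutoffAt N y * (f y - φ n y)) V +
          (4 * c)⁻¹ * ∫ y, cutoffAt N y * (f y - φ n y) ^ 2 := by
      intro n
      have e1 : interfaceForm β cβ pp pm g0 (fun y => cutoffAt N y * (f y - φ n y)) V =
          interfaceForm β cβ pp pm g0 (fun y => cutoffAt N y * f y) V -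
            interfaceForm β cβ pp pm g0 (fun y => cutoffAt N y * φ n y) V := by
        rw [← interfaceForm_sub hχfE (htE n) hVE]
        simp only [mul_sub]
      have hχi : Integrable (cutoffAt N) := hχ.continuous.integrable_of_hasCompactSupport hχc
      obtain ⟨L, hL⟩ := (hφ n).2.1.exists_bound_of_continuous (hφ n).1.continuous
      have i1 : Integrable (fun y => cutoffAt N y * φ n y * f y) :=
        ((htest n).1.continuous.integrable_of_hasCompactSupport (htest n).2.1).mul_bdd (c := M)
          hf.aestronglyMeasurable (Eventually.of_forall hfM)
      have i2 : Integrable (fun y => cutoffAt N y * (f y - φ n y) ^ 2) := by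
        refine hχi.mul_bdd (c := (M + L) ^ 2)
          ((hf.sub (hφm n)).pow_const 2).aestronglyMeasurable (Eventually.of_forall fun y => ?_)
        rw [norm_pow]
        exact pow_le_pow_left₀ (norm_nonneg _)
          ((norm_sub_le _ _).trans (add_le_add (hfM y) (hL y))) 2
      have h3 : -(4⁻¹ * ∫ y, cutoffAt N y * (f y - φ n y) ^ 2) ≤
          ∫ y, cutoffAt N y * φ n y * f y := by
        rw [← integral_const_mul, ← integral_neg]
        refine integral_mono (i2.const_mul _).neg i1 fun y => ?_
        have := mul_nonneg (hχ0 y) (sq_nonneg ((f y + φ n y)))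
        simp only []
        nlinarith
      rw [hweak _ (htest n)] at h3
      rw [e1, mul_inv]
      have h5 : c⁻¹ * (c * interfaceForm β cβ pp pm g0 (fun y => cutoffAt N y * φ n y) V) ≤
          c⁻¹ * (4⁻¹ * ∫ y, cutoffAt N y * (f y - φ n y) ^ 2) :=
        mul_le_mul_of_nonneg_left (by linarith) (inv_pos.2 hc).le
      rw [inv_mul_cancel_left₀ hc.ne'] at h5
      linarith
    have h3 : Tendsto (fun n => ∫ y, cutoffAt N y * (f y - φ n y) ^ 2) atTop (𝓝 0) := by
      have e : ∀ n, ∫ y, cutoffAt N y * (f y - φ n y) ^ 2 =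
          (∫⁻ y, ENNReal.ofReal (cutoffAt N y * (f y - φ n y) ^ 2)).toReal := fun n =>
        integral_eq_lintegral_of_nonneg_ae
          (Eventually.of_forall fun y => mul_nonneg (hχ0 y) (sq_nonneg _))
          (hχm.mul ((hf.sub (hφm n)).pow_const 2)).aestronglyMeasurable
      simp only [e]
      rw [← ENNReal.toReal_zero]
      refine (ENNReal.tendsto_toReal ENNReal.zero_ne_top).comp ?_
      exact tendsto_of_tendsto_of_tendsto_of_le_of_le tendsto_const_nhds (hKlim K')
        (fun n => zero_le) (fun n => hle' _ (hf.sub (hφm n)))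
    have h4 := h1.add (h3.const_mul (4 * c)⁻¹)
    rw [mul_zero, add_zero] at h4
    exact ge_of_tendsto' h4 h2
  have h1 := tendsto_interfaceForm_zero
    (fun n => hf.sub ((contDiff_cutoffAt n).continuous.measurable.mul hf)) hV hVE
    (tendsto_energy_sub_cutoffAt_mul hβ hcβ hpp hpm hpp1 hpm1 hf hfM hfE)
  refine ge_of_tendsto' h1 fun N => ?_
  have h2 : interfaceForm β cβ pp pm g0 (fun y => f y - cutoffAt N y * f y) V = _ :=
    interfaceForm_sub hfE (hcut N).1 hVE
  have h3 := (hcut N).2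
  calc _ ≤ _ := le_sub_self_iff _ |>.2 h3
    _ = _ := h2.symm

end Cutoff

section WeakFormulation

variable {β cβ pp pm g0 chat T : ℝ} {φ W0 : ℝ → ℝ} {W : ℝ → ℝ → ℝ}

lemma setIntegral_integral_mul {X : Type*} [MeasurableSpace X] {μ : Measure X} [SFinite μ]
    {F : X → ℝ} (hF : Integrable F μ) {u : ℝ → X → ℝ} (hu : Measurable (Function.uncurry u))
    {C : ℝ} (hC : ∀ t x, |u t x| ≤ C) (t0 : ℝ) :
    ∫ t in Ioc 0 t0, ∫ x, F x * u t x ∂μ = ∫ x, F x * (∫ t in Ioc 0 t0, u t x) ∂μ := by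
  have hi : Integrable (Function.uncurry fun t x => F x * u t x)
      ((volume.restrict (Ioc 0 t0)).prod μ) :=
    (hF.comp_snd _).mul_bdd (c := C) hu.aestronglyMeasurable
      (Eventually.of_forall fun p => hC p.1 p.2)
  rw [integral_integral_swap hi]
  simp only [integral_const_mul]

lemma integral_mul_setIntegral_mul_neg (hβ : 1 < β) (hcβ : 0 < cβ) (hφ : IsSpaceTest φ)
    {V : ℝ → ℝ} (hV : Measurable V) {M : ℝ} (hM : ∀ y, |V y| ≤ M) :
    ∫ y, φ y * (pm * (∫ y' in {y' : ℝ | y * y' < 0}, qbeta β cβ (y - y') * (V (-y') - V y'))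
      + g0 * (∫ y' in {y' : ℝ | y * y' < 0}, qbeta β cβ (y - y') * (T - V y'))) =
    ∫ p, crossing β cβ φ p * (pm * (V (-p.2) - V p.2) + g0 * (T - V p.2)) := by
  have hΦ := integrable_crossing hβ hcβ hφ
  have hset : ∀ y : ℝ, MeasurableSet {y' : ℝ | y * y' < 0} := fun y =>
    measurableSet_lt (by fun_prop) measurable_const
  have e : ∀ (y : ℝ) (A : ℝ → ℝ), φ y * ∫ y' in {y' : ℝ | y * y' < 0}, qbeta β cβ (y - y') * A y' =
      ∫ y', crossing β cβ φ (y, y') * A y' := by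
    intro y A
    rw [← integral_indicator (hset y), ← integral_const_mul]
    congr 1; ext y'
    by_cases h : y * y' < 0
    · rw [indicator_of_mem (show y' ∈ {y' : ℝ | y * y' < 0} from h), crossing, if_pos h]
      ring
    · rw [indicator_of_notMem (show y' ∉ {y' : ℝ | y * y' < 0} from h), crossing, if_neg h]
      ring
  have i1 : Integrable (fun p : ℝ × ℝ => crossing β cβ φ p * (V (-p.2) - V p.2)) :=
    hΦ.mul_bdd (c := M + M) (by fun_prop)
      (Eventually.of_forall fun p => (norm_sub_le _ _).trans (add_le_add (hM _) (hM _)))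
  have i2 : Integrable (fun p : ℝ × ℝ => crossing β cβ φ p * (T - V p.2)) :=
    hΦ.mul_bdd (c := |T| + M) (by fun_prop : Measurable _).aestronglyMeasurable
      (Eventually.of_forall fun p => (norm_sub_le _ _).trans (add_le_add le_rfl (hM _)))
  have e1 : ∀ y, φ y *
      (pm * (∫ y' in {y' : ℝ | y * y' < 0}, qbeta β cβ (y - y') * (V (-y') - V y'))
      + g0 * (∫ y' in {y' : ℝ | y * y' < 0}, qbeta β cβ (y - y') * (T - V y'))) =
      pm * (∫ y', crossing β cβ φ (y, y') * (V (-y') - V y')) +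
      g0 * ∫ y', crossing β cβ φ (y, y') * (T - V y') := by
    intro y
    rw [← e y (fun y' => V (-y') - V y'), ← e y (fun y' => T - V y')]
    ring
  simp only [e1]
  rw [integral_add (i1.integral_prod_left.const_mul pm) (i2.integral_prod_left.const_mul g0),
    integral_const_mul, integral_const_mul]
  have e2 : ∫ y, ∫ y', crossing β cβ φ (y, y') * (V (-y') - V y') =
      ∫ p, crossing β cβ φ p * (V (-p.2) - V p.2) := (integral_prod _ i1).symm
  have e3 : ∫ y, ∫ y', crossing β cβ φ (y, y') * (T - V y') =
      ∫ p, crossing β cβ φ p * (T - V p.2) := (integral_prod _ i2).symm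
  rw [e2, e3, ← integral_const_mul, ← integral_const_mul,
    ← integral_add (i1.const_mul pm) (i2.const_mul g0)]
  congr 1; ext p; ring

lemma isTestFn_mul {θ : ℝ → ℝ} (hθ : ContDiff ℝ (⊤ : ℕ∞) θ) (hθc : HasCompactSupport θ)
    (hφ : IsSpaceTest φ) : IsTestFn (fun t y => θ t * φ y) := by
  have hsub : Function.support (Function.uncurry fun t y => θ t * φ y) ⊆
      tsupport θ ×ˢ tsupport φ := by
    rintro ⟨t, y⟩ h
    have h' : θ t * φ y ≠ 0 := h
    exact ⟨subset_tsupport _ (left_ne_zero_of_mul h'), subset_tsupport _ (right_ne_zero_of_mul h')⟩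
  have hK : IsCompact (tsupport θ ×ˢ tsupport φ) := hθc.isCompact.prod hφ.2.1.isCompact
  refine ⟨?_, HasCompactSupport.of_support_subset_isCompact hK hsub, ?_⟩
  · exact (hθ.comp contDiff_fst).mul (hφ.1.comp contDiff_snd)
  · exact (closure_minimal hsub hK.isClosed).trans fun p hp => hφ.2.2 hp.2

lemma IsWeakSolution.integral_mul_eq (hβ : 1 < β) (hcβ : 0 < cβ)
    (hW : IsWeakSolution β cβ chat pm g0 T W0 W) (hWm : Measurable (Function.uncurry W))
    {M : ℝ} (hM : ∀ t y, |W t y| ≤ M) (hφ : IsSpaceTest φ) {t0 : ℝ} (ht0 : 0 < t0) :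
    ∫ y, φ y * W t0 y = (∫ y, φ y * W0 y) -
      chat * (∫ y, pvLambda β cβ φ y * ∫ t in Ioc 0 t0, W t y) +
      chat * ∫ p, crossing β cβ φ p *
        (pm * ((∫ t in Ioc 0 t0, W t (-p.2)) - ∫ t in Ioc 0 t0, W t p.2) +
          g0 * (t0 * T - ∫ t in Ioc 0 t0, W t p.2)) := by
  let θ : ContDiffBump (0 : ℝ) := ⟨t0 + 1, t0 + 2, by linarith, by linarith⟩
  have hball : ∀ t ∈ Icc 0 t0, t ∈ Metric.ball (0 : ℝ) θ.rIn := fun t ht => by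
    rw [mem_ball_zero_iff, Real.norm_of_nonneg ht.1]
    change t < t0 + 1
    linarith [ht.2]
  have hθ1 : ∀ t ∈ Icc 0 t0, θ t = 1 := fun t ht =>
    θ.one_of_mem_closedBall (Metric.ball_subset_closedBall (hball t ht))
  have hθd : ∀ t ∈ Icc 0 t0, ∀ y, deriv (fun s => θ s * φ y) t = 0 := fun t ht y => by
    have h1 : (fun s => θ s * φ y) =ᶠ[𝓝 t] fun _ => φ y := by
      filter_upwards [θ.eventuallyEq_one_of_mem_ball (hball t ht)] with s hs
      simp [hs]
    rw [h1.deriv_eq, deriv_const]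
  have hweak := hW t0 ht0 _ (isTestFn_mul θ.contDiff θ.hasCompactSupport hφ)
  have hWt : ∀ t, Measurable (W t) := fun t =>
    hWm.comp (by fun_prop : Measurable fun y : ℝ => (t, y))
  have hWy : ∀ y, Measurable (fun t => W t y) := fun y =>
    hWm.comp (by fun_prop : Measurable fun t : ℝ => (t, y))
  have hWi : ∀ y, IntegrableOn (fun t => W t y) (Ioc 0 t0) := fun y =>
    integrableOn_Ioc_of_bdd (hWy y) fun t => hM t y
  have hA : ∫ t in Ioc 0 t0, ∫ y, (deriv (fun s => θ s * φ y) t -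
      chat * pvLambda β cβ (fun y' => θ t * φ y') y) * W t y =
      -(chat * ∫ y, pvLambda β cβ φ y * ∫ t in Ioc 0 t0, W t y) := by
    have h1 : ∫ t in Ioc 0 t0, ∫ y, (deriv (fun s => θ s * φ y) t -
        chat * pvLambda β cβ (fun y' => θ t * φ y') y) * W t y =
        ∫ t in Ioc 0 t0, -(chat * ∫ y, pvLambda β cβ φ y * W t y) := by
      refine setIntegral_congr_fun measurableSet_Ioc fun t ht => ?_
      have ht' := Ioc_subset_Icc_self ht
      simp only [hθd t ht', hθ1 t ht', one_mul]
      rw [← integral_const_mul, ← integral_neg]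
      congr 1; ext y; ring
    rw [h1, integral_neg, integral_const_mul,
      setIntegral_integral_mul (integrable_pvLambda hβ hcβ hφ.1 hφ.2.1) hWm hM]
  have hB : ∫ t in Ioc 0 t0, ∫ y, θ t * φ y *
      (pm * (∫ y' in {y' : ℝ | y * y' < 0}, qbeta β cβ (y - y') * (W t (-y') - W t y'))
        + g0 * (∫ y' in {y' : ℝ | y * y' < 0}, qbeta β cβ (y - y') * (T - W t y'))) =
      ∫ p, crossing β cβ φ p *
        (pm * ((∫ t in Ioc 0 t0, W t (-p.2)) - ∫ t in Ioc 0 t0, W t p.2) +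
          g0 * (t0 * T - ∫ t in Ioc 0 t0, W t p.2)) := by
    have h1 : ∫ t in Ioc 0 t0, ∫ y, θ t * φ y *
        (pm * (∫ y' in {y' : ℝ | y * y' < 0}, qbeta β cβ (y - y') * (W t (-y') - W t y'))
          + g0 * (∫ y' in {y' : ℝ | y * y' < 0}, qbeta β cβ (y - y') * (T - W t y'))) =
        ∫ t in Ioc 0 t0, ∫ p : ℝ × ℝ, crossing β cβ φ p *
          (pm * (W t (-p.2) - W t p.2) + g0 * (T - W t p.2)) := by
      refine setIntegral_congr_fun measurableSet_Ioc fun t ht => ?_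
      simp only [hθ1 t (Ioc_subset_Icc_self ht), one_mul]
      exact integral_mul_setIntegral_mul_neg hβ hcβ hφ (hWt t) (hM t)
    have hm1 : Measurable fun q : ℝ × (ℝ × ℝ) => W q.1 (-q.2.2) :=
      hWm.comp (by fun_prop : Measurable fun q : ℝ × (ℝ × ℝ) => (q.1, -q.2.2))
    have hm2 : Measurable fun q : ℝ × (ℝ × ℝ) => W q.1 q.2.2 :=
      hWm.comp (by fun_prop : Measurable fun q : ℝ × (ℝ × ℝ) => (q.1, q.2.2))
    rw [h1, setIntegral_integral_mul (integrable_crossing hβ hcβ hφ)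
      (u := fun t p => pm * (W t (-p.2) - W t p.2) + g0 * (T - W t p.2))
      (C := |pm| * (M + M) + |g0| * (|T| + M))
      (((hm1.sub hm2).const_mul pm).add ((measurable_const.sub hm2).const_mul g0))
      fun t p => ?_]
    · congr 1; ext p
      congr 1
      have i1 : IntegrableOn (fun t => W t (-p.2) - W t p.2) (Ioc 0 t0) := (hWi _).sub (hWi _)
      have i2 : IntegrableOn (fun t => T - W t p.2) (Ioc 0 t0) :=
        (integrable_const T).sub (hWi _)
      rw [integral_add (i1.const_mul pm) (i2.const_mul g0), integral_const_mul,
        integral_const_mul, integral_sub (hWi _) (hWi _), integral_sub (integrable_const T) (hWi _)]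
      simp [ht0.le]
    · refine (abs_add_le _ _).trans ?_
      rw [abs_mul, abs_mul]
      gcongr
      · exact (abs_sub _ _).trans (add_le_add (hM _ _) (hM _ _))
      · exact (abs_sub _ _).trans (add_le_add le_rfl (hM _ _))
  rw [hA, hB] at hweak
  have hθt := hθ1 t0 ⟨ht0.le, le_rfl⟩
  have hθ0 := hθ1 0 ⟨le_rfl, ht0.le⟩
  simp only [hθt, hθ0, one_mul] at hweak
  linarith

/-- The difference of two weak solutions with the same datum satisfies the time-integrated
homogeneous equation. -/
lemma IsWeakSolution.integral_mul_sub_eq (hβ : 1 < β) (hcβ : 0 < cβ) (hpp : 0 ≤ pp) (hpm : 0 ≤ pm)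
    (hg0 : 0 < g0) (hsum : pp + pm + g0 = 1) {W1 W2 : ℝ → ℝ → ℝ}
    (hW1 : IsWeakSolution β cβ chat pm g0 T W0 W1) (hW2 : IsWeakSolution β cβ chat pm g0 T W0 W2)
    (hW1m : Measurable (Function.uncurry W1)) (hW2m : Measurable (Function.uncurry W2))
    {M1 M2 : ℝ} (hM1 : ∀ t y, |W1 t y| ≤ M1) (hM2 : ∀ t y, |W2 t y| ≤ M2)
    (hφ : IsSpaceTest φ) {t0 : ℝ} (ht0 : 0 < t0)
    (hE : FiniteEnergy β cβ pp pm g0 (fun y => ∫ t in Ioc 0 t0, (W1 t y - W2 t y))) :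
    ∫ y, φ y * (W1 t0 y - W2 t0 y) = -(chat * interfaceForm β cβ pp pm g0 φ
      (fun y => ∫ t in Ioc 0 t0, (W1 t y - W2 t y))) := by
  have hφi : Integrable φ := hφ.1.continuous.integrable_of_hasCompactSupport hφ.2.1
  have hpt : ∀ {W : ℝ → ℝ → ℝ}, Measurable (Function.uncurry W) → Measurable (W t0) := fun h =>
    h.comp (by fun_prop : Measurable fun y : ℝ => (t0, y))
  have hVm : ∀ {W : ℝ → ℝ → ℝ}, Measurable (Function.uncurry W) →
      Measurable (fun y => ∫ t in Ioc 0 t0, W t y) := fun h =>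
    (measurable_setIntegral_Ioc h).comp (by fun_prop : Measurable fun y : ℝ => (t0, y))
  have hVb : ∀ {W : ℝ → ℝ → ℝ} {M : ℝ}, (∀ t y, |W t y| ≤ M) →
      ∀ y, |∫ t in Ioc 0 t0, W t y| ≤ M * t0 := fun {W M} h y => by
    have := norm_setIntegral_le_of_norm_le_const (μ := (volume : Measure ℝ)) (s := Ioc 0 t0)
      (f := fun t => W t y) (C := M) (by simp) fun t _ => h t y
    simpa [ht0.le] using this
  have hti : ∀ {W : ℝ → ℝ → ℝ} {M : ℝ}, Measurable (Function.uncurry W) → (∀ t y, |W t y| ≤ M) →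
      ∀ y, IntegrableOn (fun t => W t y) (Ioc 0 t0) := fun h hb y =>
    integrableOn_Ioc_of_bdd (h.comp (by fun_prop : Measurable fun t : ℝ => (t, y)))
      fun t => hb t y
  set V1 := fun y => ∫ t in Ioc 0 t0, W1 t y with hV1
  set V2 := fun y => ∫ t in Ioc 0 t0, W2 t y with hV2
  have hV : (fun y => ∫ t in Ioc 0 t0, (W1 t y - W2 t y)) = fun y => V1 y - V2 y := by
    ext y
    exact integral_sub (hti hW1m hM1 y) (hti hW2m hM2 y)
  rw [hV] at hE ⊢
  have hV1m : Measurable V1 := hVm hW1m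
  have hV2m : Measurable V2 := hVm hW2m
  have hV1b := hVb hM1
  have hV2b := hVb hM2
  rw [interfaceForm_eq hβ hcβ hpp hpm hg0 hsum hφ (V := fun y => V1 y - V2 y)
    (hV1m.sub hV2m) (M := M1 * t0 + M2 * t0)
    (fun y => (abs_sub _ _).trans (add_le_add (hV1b y) (hV2b y))) hE]
  have hs1 := hW1.integral_mul_eq hβ hcβ hW1m hM1 hφ ht0
  have hs2 := hW2.integral_mul_eq hβ hcβ hW2m hM2 hφ ht0
  have hΛ := integrable_pvLambda hβ hcβ hφ.1 hφ.2.1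
  have hΦ := integrable_crossing hβ hcβ hφ
  have a1 : ∫ y, φ y * (W1 t0 y - W2 t0 y) = (∫ y, φ y * W1 t0 y) - ∫ y, φ y * W2 t0 y := by
    rw [← integral_sub (hφi.mul_bdd (c := M1) (hpt hW1m).aestronglyMeasurable
      (Eventually.of_forall (hM1 t0))) (hφi.mul_bdd (c := M2) (hpt hW2m).aestronglyMeasurable
      (Eventually.of_forall (hM2 t0)))]
    simp only [mul_sub]
  have a2 : ∫ y, pvLambda β cβ φ y * (V1 y - V2 y) =
      (∫ y, pvLambda β cβ φ y * V1 y) - ∫ y, pvLambda β cβ φ y * V2 y := by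
    rw [← integral_sub (hΛ.mul_bdd (c := M1 * t0) hV1m.aestronglyMeasurable
      (Eventually.of_forall hV1b)) (hΛ.mul_bdd (c := M2 * t0) hV2m.aestronglyMeasurable
      (Eventually.of_forall hV2b))]
    simp only [mul_sub]
  have hcr : ∀ {V : ℝ → ℝ} {M : ℝ}, Measurable V → (∀ y, |V y| ≤ M) →
      Integrable (fun p : ℝ × ℝ => crossing β cβ φ p *
        (pm * (V (-p.2) - V p.2) + g0 * (t0 * T - V p.2))) := fun {V M} h hb =>
    hΦ.mul_bdd (c := |pm| * (M + M) + |g0| * (|t0 * T| + M))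
      (by fun_prop : Measurable _).aestronglyMeasurable
      (Eventually.of_forall fun p => by
        refine (abs_add_le _ _).trans ?_
        rw [abs_mul, abs_mul]
        gcongr
        · exact (abs_sub _ _).trans (add_le_add (hb _) (hb _))
        · exact (abs_sub _ _).trans (add_le_add le_rfl (hb _)))
  have a3 : ∫ p, crossing β cβ φ p *
      (pm * ((V1 (-p.2) - V2 (-p.2)) - (V1 p.2 - V2 p.2)) - g0 * (V1 p.2 - V2 p.2)) =
      (∫ p, crossing β cβ φ p * (pm * (V1 (-p.2) - V1 p.2) + g0 * (t0 * T - V1 p.2))) -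
      ∫ p, crossing β cβ φ p * (pm * (V2 (-p.2) - V2 p.2) + g0 * (t0 * T - V2 p.2)) := by
    rw [← integral_sub (hcr hV1m hV1b) (hcr hV2m hV2b)]
    congr 1; ext p; ring
  rw [a1, a2, a3, hs1, hs2]
  ring

end WeakFormulation

section Uniqueness

variable {β cβ pp pm g0 chat T : ℝ} {f g W0 : ℝ → ℝ} {W W1 W2 : ℝ → ℝ → ℝ} {t : ℝ}

lemma energy_sub_le (f : ℝ → ℝ) (hg : Measurable g) :
    energy β cβ pp pm g0 (fun y => f y - g y) ≤
      2 * energy β cβ pp pm g0 f + 2 * energy β cβ pp pm g0 g := by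
  have hJ := measurable_jumpGrad (β := β) (cβ := cβ) (pp := pp) (pm := pm) hg
  have hK := measurable_killGrad (β := β) (cβ := cβ) (g0 := g0) hg
  unfold energy
  rw [← lintegral_const_mul' _ _ (by norm_num), ← lintegral_const_mul' _ _ (by norm_num),
    ← lintegral_add_right _ (by fun_prop)]
  refine lintegral_mono fun p => ?_
  rw [← ENNReal.ofReal_ofNat, ← ENNReal.ofReal_mul (by norm_num),
    ← ENNReal.ofReal_mul (by norm_num), ← ENNReal.ofReal_add (by positivity) (by positivity)]
  refine ENNReal.ofReal_le_ofReal ?_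
  rw [jumpGrad_sub, killGrad_sub]
  nlinarith [sq_nonneg (jumpGrad β cβ pp pm f p + jumpGrad β cβ pp pm g p),
    sq_nonneg (killGrad β cβ g0 f p + killGrad β cβ g0 g p)]

lemma measurable_uncurry_jumpGrad (hW : Measurable (Function.uncurry W)) :
    Measurable (Function.uncurry fun s => jumpGrad β cβ pp pm (W s)) := by
  have h1 : Measurable fun q : ℝ × (ℝ × ℝ) => W q.1 q.2.1 :=
    hW.comp (by fun_prop : Measurable fun q : ℝ × (ℝ × ℝ) => (q.1, q.2.1))
  have h2 : Measurable fun q : ℝ × (ℝ × ℝ) => W q.1 q.2.2 :=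
    hW.comp (by fun_prop : Measurable fun q : ℝ × (ℝ × ℝ) => (q.1, q.2.2))
  exact ((measurable_jumpKernel.comp measurable_snd).sqrt).mul (h1.sub h2)

lemma measurable_uncurry_killGrad (hW : Measurable (Function.uncurry W)) :
    Measurable (Function.uncurry fun s => killGrad β cβ g0 (W s)) := by
  have h1 : Measurable fun q : ℝ × (ℝ × ℝ) => W q.1 q.2.1 :=
    hW.comp (by fun_prop : Measurable fun q : ℝ × (ℝ × ℝ) => (q.1, q.2.1))
  exact ((measurable_killKernel.comp measurable_snd).sqrt).mul h1

lemma measurable_uncurry_sq_grad (hW : Measurable (Function.uncurry W)) :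
    Measurable fun q : ℝ × (ℝ × ℝ) => ENNReal.ofReal
      (jumpGrad β cβ pp pm (W q.1) q.2 ^ 2 + killGrad β cβ g0 (W q.1) q.2 ^ 2) :=
  (((measurable_uncurry_jumpGrad hW).pow_const 2).add
    ((measurable_uncurry_killGrad hW).pow_const 2)).ennreal_ofReal

lemma measurable_energy (hW : Measurable (Function.uncurry W)) :
    Measurable fun s => energy β cβ pp pm g0 (W s) :=
  (measurable_uncurry_sq_grad hW).lintegral_prod_right'

lemma integrable_sq_of_lintegral_energy_lt_top (hW : Measurable (Function.uncurry W))
    (hE : ∫⁻ s in Ioc 0 t, energy β cβ pp pm g0 (W s) < ⊤) :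
    Integrable (fun q : ℝ × (ℝ × ℝ) => jumpGrad β cβ pp pm (W q.1) q.2 ^ 2)
      ((volume.restrict (Ioc 0 t)).prod volume) ∧
    Integrable (fun q : ℝ × (ℝ × ℝ) => killGrad β cβ g0 (W q.1) q.2 ^ 2)
      ((volume.restrict (Ioc 0 t)).prod volume) := by
  have hJ := (measurable_uncurry_jumpGrad (β := β) (cβ := cβ) (pp := pp) (pm := pm) hW).pow_const 2
  have hK := (measurable_uncurry_killGrad (β := β) (cβ := cβ) (g0 := g0) hW).pow_const 2
  have h : ∫⁻ q : ℝ × (ℝ × ℝ), ENNReal.ofReal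
      (jumpGrad β cβ pp pm (W q.1) q.2 ^ 2 + killGrad β cβ g0 (W q.1) q.2 ^ 2)
      ∂((volume.restrict (Ioc 0 t)).prod volume) < ⊤ := by
    rw [lintegral_prod _ (measurable_uncurry_sq_grad hW).aemeasurable]
    exact hE
  have hsum : Integrable (fun q : ℝ × (ℝ × ℝ) =>
      jumpGrad β cβ pp pm (W q.1) q.2 ^ 2 + killGrad β cβ g0 (W q.1) q.2 ^ 2)
      ((volume.restrict (Ioc 0 t)).prod volume) :=
    ⟨(hJ.add hK).aestronglyMeasurable,
      (hasFiniteIntegral_iff_ofReal (Eventually.of_forall fun _ => by positivity)).2 h⟩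
  refine ⟨hsum.mono' hJ.aestronglyMeasurable (Eventually.of_forall fun q => ?_),
    hsum.mono' hK.aestronglyMeasurable (Eventually.of_forall fun q => ?_)⟩
  · rw [Real.norm_of_nonneg (sq_nonneg _)]
    exact le_add_of_nonneg_right (sq_nonneg _)
  · rw [Real.norm_of_nonneg (sq_nonneg _)]
    exact le_add_of_nonneg_left (sq_nonneg _)

lemma jumpGrad_setIntegral (hW : Measurable (Function.uncurry W)) {M : ℝ}
    (hM : ∀ s y, |W s y| ≤ M) (s : ℝ) :
    jumpGrad β cβ pp pm (fun y => ∫ r in Ioc 0 s, W r y) =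
      fun p => ∫ r in Ioc 0 s, jumpGrad β cβ pp pm (W r) p := by
  have hi : ∀ y, IntegrableOn (fun r => W r y) (Ioc 0 s) := fun y =>
    integrableOn_Ioc_of_bdd (hW.comp (by fun_prop : Measurable fun r : ℝ => (r, y)))
      fun r => hM r y
  ext p
  simp only [jumpGrad]
  rw [integral_const_mul, integral_sub (hi _) (hi _)]

lemma killGrad_setIntegral (s : ℝ) :
    killGrad β cβ g0 (fun y => ∫ r in Ioc 0 s, W r y) =
      fun p => ∫ r in Ioc 0 s, killGrad β cβ g0 (W r) p := by
  ext p
  simp only [killGrad]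
  rw [integral_const_mul]

lemma exists_jumpGrad_le {M : ℝ} (hM : ∀ s y, |W s y| ≤ M) (p : ℝ × ℝ) :
    ∃ C, ∀ s, |jumpGrad β cβ pp pm (W s) p| ≤ C := by
  refine ⟨√(jumpKernel β cβ pp pm p) * (M + M), fun s => ?_⟩
  rw [jumpGrad, abs_mul, abs_of_nonneg (Real.sqrt_nonneg _)]
  gcongr
  exact (abs_sub _ _).trans (add_le_add (hM _ _) (hM _ _))

lemma exists_killGrad_le {M : ℝ} (hM : ∀ s y, |W s y| ≤ M) (p : ℝ × ℝ) :
    ∃ C, ∀ s, |killGrad β cβ g0 (W s) p| ≤ C := by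
  refine ⟨√(killKernel β cβ g0 p) * M, fun s => ?_⟩
  rw [killGrad, abs_mul, abs_of_nonneg (Real.sqrt_nonneg _)]
  gcongr
  exact hM _ _

lemma finiteEnergy_setIntegral (hW : Measurable (Function.uncurry W)) {M : ℝ}
    (hM : ∀ s y, |W s y| ≤ M) (hE : ∫⁻ s in Ioc 0 t, energy β cβ pp pm g0 (W s) < ⊤)
    {s : ℝ} (hst : s ≤ t) : FiniteEnergy β cβ pp pm g0 (fun y => ∫ r in Ioc 0 s, W r y) := by
  obtain ⟨h1, h2⟩ := integrable_sq_of_lintegral_energy_lt_top hW hE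
  constructor
  · rw [jumpGrad_setIntegral hW hM]
    exact memLp_setIntegral_Ioc (measurable_uncurry_jumpGrad hW) (exists_jumpGrad_le hM) h1 hst
  · rw [killGrad_setIntegral]
    exact memLp_setIntegral_Ioc (measurable_uncurry_killGrad hW) (exists_killGrad_le hM) h2 hst

/-- The energy of the time integral is the time integral of twice the form. -/
lemma energy_setIntegral (hW : Measurable (Function.uncurry W)) {M : ℝ}
    (hM : ∀ s y, |W s y| ≤ M) (hE : ∫⁻ s in Ioc 0 t, energy β cβ pp pm g0 (W s) < ⊤) :
    energy β cβ pp pm g0 (fun y => ∫ r in Ioc 0 t, W r y) = ENNReal.ofReal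
      (2 * ∫ s in Ioc 0 t, interfaceForm β cβ pp pm g0 (W s) fun y => ∫ r in Ioc 0 s, W r y) := by
  obtain ⟨h1, h2⟩ := integrable_sq_of_lintegral_energy_lt_top hW hE
  have hJ := measurable_uncurry_jumpGrad (β := β) (cβ := cβ) (pp := pp) (pm := pm) hW
  have hK := measurable_uncurry_killGrad (β := β) (cβ := cβ) (g0 := g0) hW
  have hJb := exists_jumpGrad_le (β := β) (cβ := cβ) (pp := pp) (pm := pm) hM
  have hKb := exists_killGrad_le (β := β) (cβ := cβ) (g0 := g0) hM
  have m1 := (memLp_setIntegral_Ioc hJ hJb h1 le_rfl).integrable_sq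
  have m2 := (memLp_setIntegral_Ioc hK hKb h2 le_rfl).integrable_sq
  have i1 := (integrable_mul_setIntegral_Ioc hJ hJb h1).integral_prod_left
  have i2 := (integrable_mul_setIntegral_Ioc hK hKb h2).integral_prod_left
  have m12 : Integrable (fun p : ℝ × ℝ => (∫ r in Ioc 0 t, jumpGrad β cβ pp pm (W r) p) ^ 2 +
      (∫ r in Ioc 0 t, killGrad β cβ g0 (W r) p) ^ 2) := m1.add m2
  simp only [interfaceForm, energy, jumpGrad_setIntegral hW hM, killGrad_setIntegral]
  rw [← ofReal_integral_eq_lintegral_ofReal m12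
    (Eventually.of_forall fun p => add_nonneg (sq_nonneg _) (sq_nonneg _)),
    integral_add m1 m2, integral_sq_setIntegral_Ioc hJ hJb h1,
    integral_sq_setIntegral_Ioc hK hKb h2, integral_add i1 i2, mul_add]

lemma lintegral_energy_sub_lt_top (hβ : 1 < β) (hcβ : 0 < cβ) (hpp : 0 ≤ pp) (hpm : 0 ≤ pm)
    (hg0 : 0 < g0) (hsum : pp + pm + g0 = 1)
    (hW1 : Measurable (Function.uncurry W1)) (hW2 : Measurable (Function.uncurry W2))
    (h1 : ∫⁻ s in Ioc 0 t, HnormSq β cβ pp pm g0 (fun y => W1 s y - T) < ⊤)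
    (h2 : ∫⁻ s in Ioc 0 t, HnormSq β cβ pp pm g0 (fun y => W2 s y - T) < ⊤) :
    ∫⁻ s in Ioc 0 t, energy β cβ pp pm g0 (fun y => W1 s y - W2 s y) < ⊤ := by
  have hslice : ∀ {W : ℝ → ℝ → ℝ}, Measurable (Function.uncurry W) → ∀ s,
      Measurable fun y => W s y - T := fun h s =>
    (h.comp (by fun_prop : Measurable fun y : ℝ => (s, y))).sub_const T
  have hfin : ∀ {W : ℝ → ℝ → ℝ}, Measurable (Function.uncurry W) →
      ∫⁻ s in Ioc 0 t, HnormSq β cβ pp pm g0 (fun y => W s y - T) < ⊤ →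
      ∫⁻ s in Ioc 0 t, 2 * energy β cβ pp pm g0 (fun y => W s y - T) < ⊤ := by
    intro W hW h
    rw [lintegral_const_mul' _ _ (by norm_num)]
    refine ENNReal.mul_lt_top (by norm_num) (lt_of_le_of_lt (lintegral_mono fun s => ?_) h)
    exact lintegral_energy_le_HnormSq hβ hcβ hpp hpm hg0 hsum (hslice hW s)
  have hm : Measurable fun s => 2 * energy β cβ pp pm g0 (fun y => W2 s y - T) :=
    (measurable_energy (W := fun s y => W2 s y - T) (hW2.sub_const T)).const_mul 2
  refine lt_of_le_of_lt (lintegral_mono fun s => ?_)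
    ((lintegral_add_right _ hm).trans_lt (ENNReal.add_lt_top.2 ⟨hfin hW1 h1, hfin hW2 h2⟩))
  have := energy_sub_le (β := β) (cβ := cβ) (pp := pp) (pm := pm) (g0 := g0)
    (fun y => W1 s y - T) (hslice hW2 s)
  simpa using this

lemma MemHzero.exists_tendsto_energy_sub (hβ : 1 < β) (hcβ : 0 < cβ) (hpp : 0 ≤ pp) (hpm : 0 ≤ pm)
    (hg0 : 0 < g0) (hsum : pp + pm + g0 = 1) (hf : Measurable f) (hg : Measurable g)
    (h1 : MemHzero β cβ pp pm g0 (fun y => f y - T))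
    (h2 : MemHzero β cβ pp pm g0 (fun y => g y - T)) :
    ∃ φ : ℕ → ℝ → ℝ, (∀ n, IsSpaceTest (φ n)) ∧
      Tendsto (fun n => energy β cβ pp pm g0 (fun y => (f y - g y) - φ n y)) atTop (𝓝 0) := by
  obtain ⟨φ, hφ, hφl⟩ := h1
  obtain ⟨ψ, hψ, hψl⟩ := h2
  refine ⟨fun n y => φ n y - ψ n y, fun n => ⟨(hφ n).1.sub (hψ n).1, (hφ n).2.1.sub (hψ n).2.1,
    (tsupport_sub (φ n) (ψ n)).trans (union_subset (hφ n).2.2 (hψ n).2.2)⟩, ?_⟩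
  have hlim := (ENNReal.Tendsto.const_mul (a := 2) hφl (Or.inr (by norm_num))).add
    (ENNReal.Tendsto.const_mul (a := 2) hψl (Or.inr (by norm_num)))
  rw [mul_zero, add_zero] at hlim
  refine tendsto_of_tendsto_of_tendsto_of_le_of_le tendsto_const_nhds hlim (fun n => zero_le)
    fun n => ?_
  have m1 : Measurable fun y => f y - T - φ n y :=
    (hf.sub_const T).sub (hφ n).1.continuous.measurable
  have m2 : Measurable fun y => g y - T - ψ n y :=
    (hg.sub_const T).sub (hψ n).1.continuous.measurable
  have h := energy_sub_le (β := β) (cβ := cβ) (pp := pp) (pm := pm) (g0 := g0)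
    (fun y => f y - T - φ n y) m2
  have e : (fun y => f y - g y - (φ n y - ψ n y)) =
      fun y => (f y - T - φ n y) - (g y - T - ψ n y) := by ext y; ring
  dsimp only
  rw [e]
  refine h.trans (add_le_add ?_ ?_)
  · gcongr; exact lintegral_energy_le_HnormSq hβ hcβ hpp hpm hg0 hsum m1
  · gcongr; exact lintegral_energy_le_HnormSq hβ hcβ hpp hpm hg0 hsum m2

lemma ae_eq_zero_of_forall_isSpaceTest (hf : LocallyIntegrable f)
    (h : ∀ φ, IsSpaceTest φ → ∫ y, φ y * f y = 0) : f =ᵐ[volume] 0 := by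
  have hopen : IsOpen {y : ℝ | y ≠ 0} := isOpen_ne
  have h1 := hopen.ae_eq_zero_of_integral_contDiff_smul_eq_zero
    (hf.locallyIntegrableOn _) (μ := volume) fun φ hφ hc hsub => h φ ⟨hφ, hc, hsub⟩
  filter_upwards [h1, Measure.ae_ne volume (0 : ℝ)] with y hy hy0 using hy hy0

lemma ae_eq_of_pos (hβ : 1 < β) (hcβ : 0 < cβ) (hchat : 0 < chat)
    (hpp : 0 ≤ pp) (hpm : 0 ≤ pm) (hg0 : 0 < g0) (hsum : pp + pm + g0 = 1)
    (hW1 : Measurable (Function.uncurry W1)) (hW2 : Measurable (Function.uncurry W2))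
    {M1 M2 : ℝ} (hM1 : ∀ t y, |W1 t y| ≤ M1) (hM2 : ∀ t y, |W2 t y| ≤ M2)
    (hweak1 : IsWeakSolution β cβ chat pm g0 T W0 W1)
    (hweak2 : IsWeakSolution β cβ chat pm g0 T W0 W2)
    (hreg1 : MemFrakH β cβ pp pm g0 T W1) (hreg2 : MemFrakH β cβ pp pm g0 T W2) (ht : 0 < t) :
    W1 t =ᵐ[volume] W2 t := by
  set W : ℝ → ℝ → ℝ := fun s y => W1 s y - W2 s y with hWdef
  have hW : Measurable (Function.uncurry W) := hW1.sub hW2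
  have hslice : ∀ {W : ℝ → ℝ → ℝ}, Measurable (Function.uncurry W) → ∀ s, Measurable (W s) :=
    fun h s => h.comp (by fun_prop : Measurable fun y : ℝ => (s, y))
  have hM : ∀ s y, |W s y| ≤ M1 + M2 := fun s y =>
    (abs_sub _ _).trans (add_le_add (hM1 _ _) (hM2 _ _))
  have hE : ∫⁻ s in Ioc 0 t, energy β cβ pp pm g0 (W s) < ⊤ :=
    lintegral_energy_sub_lt_top hβ hcβ hpp hpm hg0 hsum hW1 hW2 (hreg1.2.2 t ht) (hreg2.2.2 t ht)
  set V : ℝ → ℝ → ℝ := fun s y => ∫ r in Ioc 0 s, W r y with hVdef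
  have hVE : ∀ s ≤ t, FiniteEnergy β cβ pp pm g0 (V s) := fun s hs =>
    finiteEnergy_setIntegral hW hM hE hs
  have hVm : ∀ s, Measurable (V s) := hslice (measurable_setIntegral_Ioc hW)
  have hweak : ∀ s, 0 < s → s ≤ t → ∀ ψ, IsSpaceTest ψ →
      ∫ y, ψ y * W s y = -(chat * interfaceForm β cβ pp pm g0 ψ (V s)) := fun s hs hst ψ hψ =>
    hweak1.integral_mul_sub_eq hβ hcβ hpp hpm hg0 hsum hweak2 hW1 hW2 hM1 hM2 hψ hs (hVE s hst)
  have hpos : ∀ {P : ℝ → Prop}, (∀ᵐ s ∂(volume.restrict (Ioi (0 : ℝ))), P s) →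
      ∀ᵐ s ∂(volume.restrict (Ioc 0 t)), P s := fun h =>
    ae_mono (Measure.restrict_mono Ioc_subset_Ioi_self le_rfl) h
  have hform : ∀ᵐ s ∂(volume.restrict (Ioc 0 t)), interfaceForm β cβ pp pm g0 (W s) (V s) ≤ 0 := by
    filter_upwards [hpos hreg1.2.1, hpos hreg2.2.1, ae_restrict_mem measurableSet_Ioc,
      ae_lt_top (measurable_energy hW) hE.ne] with s h1 h2 hs hfin
    obtain ⟨φ, hφ, hlim⟩ := MemHzero.exists_tendsto_energy_sub hβ hcβ hpp hpm hg0 hsum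
      (hslice hW1 s) (hslice hW2 s) h1 h2
    exact interfaceForm_nonpos hβ hcβ hpp hpm hg0 hsum (hslice hW s) (hM s)
      ((finiteEnergy_iff (hslice hW s)).2 hfin) (hVm s) (hVE s hs.2) hφ hlim hchat
      (hweak s hs.1 hs.2)
  have hzero : energy β cβ pp pm g0 (V t) = 0 := by
    have h1 : energy β cβ pp pm g0 (V t) = _ := energy_setIntegral hW hM hE
    rw [h1, ENNReal.ofReal_eq_zero]
    exact mul_nonpos_of_nonneg_of_nonpos (by norm_num) (integral_nonpos_of_ae hform)
  have hWzero : W t =ᵐ[volume] 0 := by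
    refine ae_eq_zero_of_forall_isSpaceTest ?_ fun φ hφ => ?_
    · exact (locallyIntegrable_const (M1 + M2)).mono (hslice hW t).aestronglyMeasurable
        (Eventually.of_forall fun y => (hM t y).trans (le_abs_self _))
    · have h1 := enorm_interfaceForm_le (β := β) (cβ := cβ) (pp := pp) (pm := pm) (g0 := g0)
        hφ.1.continuous.measurable (hVm t)
      rw [hzero, ENNReal.zero_rpow_of_pos (by norm_num), mul_zero, mul_zero, nonpos_iff_eq_zero,
        enorm_eq_zero] at h1
      rw [hweak t ht le_rfl φ hφ, h1, mul_zero, neg_zero]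
  filter_upwards [hWzero] with y hy
  exact sub_eq_zero.1 hy

lemma ae_eq_zero_time_of_forall_pos {U1 U2 : ℝ → ℝ → ℝ} {T1 T2 : ℝ}
    {u1 u2 : ℝ → Lp ℝ 2 (volume : Measure ℝ)}
    (hc1 : ContinuousOn u1 (Ici 0)) (hc2 : ContinuousOn u2 (Ici 0))
    (hu1 : ∀ t, 0 ≤ t → (u1 t : ℝ → ℝ) =ᵐ[volume] fun y => U1 t y - T1)
    (hu2 : ∀ t, 0 ≤ t → (u2 t : ℝ → ℝ) =ᵐ[volume] fun y => U2 t y - T2)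
    (h : ∀ t, 0 < t → U1 t =ᵐ[volume] U2 t) : U1 0 =ᵐ[volume] U2 0 := by
  have hT : T1 = T2 := by
    have h1 : (fun _ : ℝ => T2 - T1) =ᵐ[volume] ((u1 1 - u2 1 : Lp ℝ 2 (volume : Measure ℝ)) :) := by
      filter_upwards [Lp.coeFn_sub (u1 1) (u2 1), hu1 1 zero_le_one, hu2 1 zero_le_one,
        h 1 one_pos] with y hy h1 h2 h3
      rw [hy, Pi.sub_apply, h1, h2, h3]; ring
    have h2 : MemLp (fun _ : ℝ => T2 - T1) 2 volume := (Lp.memLp (u1 1 - u2 1)).ae_eq h1.symm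
    have h3 := (memLp_const_iff (by norm_num) (by norm_num)).1 h2
    simp only [Real.volume_univ, lt_self_iff_false, or_false] at h3
    linarith
  have hpos : ∀ t, 0 < t → u1 t = u2 t := fun t ht => by
    refine Lp.ext ?_
    filter_upwards [hu1 t ht.le, hu2 t ht.le, h t ht] with y h1 h2 h3
    rw [h1, h2, h3, hT]
  have hzero : u1 0 = u2 0 := by
    have l1 : Tendsto u1 (𝓝[>] 0) (𝓝 (u1 0)) :=
      (hc1 0 self_mem_Ici).mono_left (nhdsWithin_mono _ Ioi_subset_Ici_self)
    have l2 : Tendsto u2 (𝓝[>] 0) (𝓝 (u2 0)) :=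
      (hc2 0 self_mem_Ici).mono_left (nhdsWithin_mono _ Ioi_subset_Ici_self)
    refine tendsto_nhds_unique l1 (l2.congr' ?_)
    filter_upwards [self_mem_nhdsWithin] with t ht using (hpos t ht).symm
  filter_upwards [hu1 0 le_rfl, hu2 0 le_rfl] with y h1 h2
  rw [hzero, h2, hT] at h1
  linarith

end Uniqueness

/-- bounded weak solutions of the fractional diffusion equation with
interface, with the same bounded initial datum, belonging to the class `𝔉_T`,
coincide: `W₁(t,·) = W₂(t,·)` a.e. on `ℝ` for every `t ≥ 0`. -/
theorem uniqueness_weak_solution_in_frakH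
    (β cβ chat pp pm g0 T : ℝ) (hβ : 1 < β) (hcβ : 0 < cβ) (hchat : 0 < chat)
    (hpp : 0 ≤ pp) (hpm : 0 ≤ pm) (hg0 : 0 < g0) (hsum : pp + pm + g0 = 1)
    (W0 : ℝ → ℝ) (hW0meas : Measurable W0) (hW0bdd : ∃ C : ℝ, ∀ y, |W0 y| ≤ C)
    (W1 W2 : ℝ → ℝ → ℝ)
    (hW1meas : Measurable (Function.uncurry W1))
    (hW2meas : Measurable (Function.uncurry W2))
    (hW1bdd : ∃ C : ℝ, ∀ t y, |W1 t y| ≤ C)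
    (hW2bdd : ∃ C : ℝ, ∀ t y, |W2 t y| ≤ C)
    (hweak1 : IsWeakSolution β cβ chat pm g0 T W0 W1)
    (hweak2 : IsWeakSolution β cβ chat pm g0 T W0 W2)
    (hreg1 : MemFrakH β cβ pp pm g0 T W1)
    (hreg2 : MemFrakH β cβ pp pm g0 T W2) :
    ∀ t : ℝ, 0 ≤ t → W1 t =ᵐ[volume] W2 t := by
  obtain ⟨M1, hM1⟩ := hW1bdd
  obtain ⟨M2, hM2⟩ := hW2bdd
  have hpos : ∀ t, 0 < t → W1 t =ᵐ[volume] W2 t := fun t ht =>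
    ae_eq_of_pos hβ hcβ hchat hpp hpm hg0 hsum hW1meas hW2meas hM1 hM2 hweak1 hweak2
      hreg1 hreg2 ht
  obtain ⟨⟨T1, u1, hc1, hu1⟩, -⟩ := hreg1
  obtain ⟨⟨T2, u2, hc2, hu2⟩, -⟩ := hreg2
  intro t ht
  rcases ht.eq_or_lt with rfl | h
  · exact ae_eq_zero_time_of_forall_pos hc1 hc2 hu1 hu2 hpos
  · exact hpos t h
end
end

section
/- The family (S_t)_{t≥0} is a semigroup on the interface class C_0: for every W0 ∈ C_0 and all s, t ≥ 0, S_{t+s}W0 = S_t(S_sW0) as functions on ℝ_*×𝕋_* (each side being understood via the continuous extension of the defining formula off the lines y = 0 and y = ϖ(k)·(time)). Moreover S_0W0 = W0. -/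
open MeasureTheory Real Set Filter Topology

noncomputable section

/-- Membership in the interface class `C_0` (temperature `T = 0`), for functions
`F(y,k)` on `ℝ_*×𝕋_*`. The torus `𝕋` is modelled by `ℝ` with functions periodic of
period `1`; `k ∈ 𝕋_*` means `Int.fract k ≠ 0`. -/
structure InterfaceClass0 (pp pm : ℝ → ℝ) (F : ℝ → ℝ → ℝ) : Prop where
  periodic : ∀ y : ℝ, Function.Periodic (F y) 1
  bounded : ∃ C : ℝ, ∀ y k : ℝ, y ≠ 0 → Int.fract k ≠ 0 → |F y k| ≤ C
  continuous : ContinuousOn (Function.uncurry F)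
    {p : ℝ × ℝ | p.1 ≠ 0 ∧ Int.fract p.2 ≠ 0}
  extends_interface : ∃ Fp Fm : ℝ → ℝ → ℝ,
    ContinuousOn (Function.uncurry Fp) {p : ℝ × ℝ | 0 ≤ p.1 ∧ Int.fract p.2 ≠ 0} ∧
    ContinuousOn (Function.uncurry Fm) {p : ℝ × ℝ | p.1 ≤ 0 ∧ Int.fract p.2 ≠ 0} ∧
    (∀ y k : ℝ, 0 < y → Int.fract k ≠ 0 → Fp y k = F y k) ∧
    (∀ y k : ℝ, y < 0 → Int.fract k ≠ 0 → Fm y k = F y k) ∧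
    (∀ k : ℝ, 0 < k → k ≤ 1/2 →
      Fp 0 k = pm k * Fp 0 (-k) + pp k * Fm 0 k) ∧
    (∀ k : ℝ, -(1/2) < k → k < 0 →
      Fm 0 k = pm k * Fm 0 (-k) + pp k * Fp 0 k)

open Classical in
/-- The interface free-flight semigroup. -/
def Sop (γ0 : ℝ) (Rt vg pp pm : ℝ → ℝ) (W0 : ℝ → ℝ → ℝ) (t y k : ℝ) : ℝ :=
  Real.exp (-(γ0 * Rt k * t)) *
    (if y ∈ Set.uIcc 0 (vg k * t) then
        pp k * W0 (y - vg k * t) k + pm k * W0 (-y + vg k * t) (-k)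
      else W0 (y - vg k * t) k)

/-- The value of `Sop` when the flight crosses the interface. -/
theorem Sop_of_mem {γ0 : ℝ} {Rt vg pp pm : ℝ → ℝ} {W0 : ℝ → ℝ → ℝ} {t y k : ℝ}
    (h : y ∈ Set.uIcc 0 (vg k * t)) :
    Sop γ0 Rt vg pp pm W0 t y k = Real.exp (-(γ0 * Rt k * t)) *
      (pp k * W0 (y - vg k * t) k + pm k * W0 (-y + vg k * t) (-k)) := by
  rw [Sop, if_pos h]

/-- The value of `Sop` when the flight does not cross the interface. -/
theorem Sop_of_notMem {γ0 : ℝ} {Rt vg pp pm : ℝ → ℝ} {W0 : ℝ → ℝ → ℝ} {t y k : ℝ}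
    (h : y ∉ Set.uIcc 0 (vg k * t)) :
    Sop γ0 Rt vg pp pm W0 t y k =
      Real.exp (-(γ0 * Rt k * t)) * W0 (y - vg k * t) k := by
  rw [Sop, if_neg h]

/-- A flight which crosses the interface in time `t` does not cross it again afterwards. -/
theorem sub_notMem_uIcc_of_mem {a b y : ℝ} (hab : 0 ≤ a * b) (hya : y ≠ a)
    (h : y ∈ Set.uIcc 0 a) : y - a ∉ Set.uIcc 0 b := by
  rw [Set.mem_uIcc] at h ⊢
  rcases h with ⟨h0, ha⟩ | ⟨ha, h0⟩
  · have hlt : y < a := lt_of_le_of_ne ha hya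
    rintro (⟨h1, -⟩ | ⟨h1, -⟩)
    · linarith
    · nlinarith
  · have hlt : a < y := lt_of_le_of_ne ha hya.symm
    rintro (⟨-, h1⟩ | ⟨-, h1⟩)
    · nlinarith
    · linarith

theorem mem_uIcc_add_of_mem {a b y : ℝ} (hab : 0 ≤ a * b) (h : y ∈ Set.uIcc 0 a) :
    y ∈ Set.uIcc 0 (a + b) := by
  rw [Set.mem_uIcc] at h ⊢
  rcases h with ⟨h0, ha⟩ | ⟨ha, h0⟩
  · rcases le_or_gt 0 b with hb | hb
    · left; constructor <;> linarith
    · have : a = 0 := by nlinarith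
      right; constructor <;> linarith
  · rcases le_or_gt b 0 with hb | hb
    · right; constructor <;> linarith
    · have : a = 0 := by nlinarith
      left; constructor <;> linarith

/-- If `[0, a]` misses `y`, then `[0, a + b]` contains `y` exactly when `[0, b]` contains `y - a`. -/
theorem mem_uIcc_add_iff_sub_mem {a b y : ℝ} (hy : y ≠ 0)
    (h : y ∉ Set.uIcc 0 a) :
    y ∈ Set.uIcc 0 (a + b) ↔ y - a ∈ Set.uIcc 0 b := by
  simp only [Set.mem_uIcc, not_or, not_and, not_le] at h ⊢
  obtain ⟨h1, h2⟩ := h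
  rcases lt_or_gt_of_ne hy with hy | hy
  · have hya : y < a := by
      by_contra! hc
      linarith [h2 hc]
    constructor
    · rintro (⟨h3, -⟩ | ⟨h3, -⟩)
      · linarith
      · right; constructor <;> linarith
    · rintro (⟨h3, -⟩ | ⟨h3, -⟩)
      · linarith
      · right; constructor <;> linarith
  · have hya : a < y := h1 hy.le
    constructor
    · rintro (⟨-, h3⟩ | ⟨-, h3⟩)
      · left; constructor <;> linarith
      · linarith
    · rintro (⟨-, h3⟩ | ⟨-, h3⟩)
      · left; constructor <;> linarith
      · linarith

theorem neg_mem_uIcc_zero_neg {x b : ℝ} : -x ∈ Set.uIcc 0 (-b) ↔ x ∈ Set.uIcc 0 b := by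
  simp only [Set.mem_uIcc]
  constructor <;> rintro (⟨h1, h2⟩ | ⟨h1, h2⟩)
  · right; constructor <;> linarith
  · left; constructor <;> linarith
  · right; constructor <;> linarith
  · left; constructor <;> linarith

/-- `(S_t)_{t≥0}` is a semigroup on the interface class `C_0`: for
every `W₀ ∈ C_0` and all `s,t ≥ 0`, `S_{t+s}W₀ = S_t(S_sW₀)` as functions on
`ℝ_*×𝕋_*` (each side understood off the exceptional lines `y = 0`, `y = ϖ(k)t`,
`y = ϖ(k)(t+s)`, where both sides are given by the defining formula, the extension
by continuity being determined there). Moreover `S_0W₀ = W₀`. -/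
theorem interface_semigroup_property
    (γ0 : ℝ) (hγ0 : 0 < γ0)
    (Rt vg pp pm gg : ℝ → ℝ)
    (hRtcont : Continuous Rt) (hRteven : ∀ k, Rt (-k) = Rt k)
    (hRtnonneg : ∀ k, 0 ≤ Rt k)
    (hvgcont : ContinuousOn vg {k : ℝ | Int.fract k ≠ 0})
    (hvgodd : ∀ k, vg (-k) = -vg k)
    (hppcont : Continuous pp) (hpmcont : Continuous pm) (hggcont : Continuous gg)
    (hppeven : ∀ k, pp (-k) = pp k) (hpmeven : ∀ k, pm (-k) = pm k)
    (hpppos : ∀ k, 0 < pp k) (hpmpos : ∀ k, 0 < pm k) (hggpos : ∀ k, 0 < gg k)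
    (hsum : ∀ k, pp k + pm k + gg k = 1)
    (W0 : ℝ → ℝ → ℝ) (hW0 : InterfaceClass0 pp pm W0) :
    (∀ s t : ℝ, 0 ≤ s → 0 ≤ t → ∀ y k : ℝ, Int.fract k ≠ 0 →
      y ≠ 0 → y ≠ vg k * t → y ≠ vg k * (t + s) →
      Sop γ0 Rt vg pp pm W0 (t + s) y k =
        Sop γ0 Rt vg pp pm (fun y' k' => Sop γ0 Rt vg pp pm W0 s y' k') t y k) ∧
    (∀ y k : ℝ, y ≠ 0 → Int.fract k ≠ 0 → Sop γ0 Rt vg pp pm W0 0 y k = W0 y k) := by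
  constructor
  · intro s t hs ht y k _ hy hyt _
    have hab : 0 ≤ vg k * t * (vg k * s) := by
      have : vg k * t * (vg k * s) = vg k ^ 2 * (t * s) := by ring
      rw [this]; positivity
    have hexp : Real.exp (-(γ0 * Rt k * (t + s))) =
        Real.exp (-(γ0 * Rt k * t)) * Real.exp (-(γ0 * Rt k * s)) := by
      rw [← Real.exp_add]; congr 1; ring
    have hadd : vg k * (t + s) = vg k * t + vg k * s := by ring
    by_cases h : y ∈ Set.uIcc 0 (vg k * t)
    · have hnot := sub_notMem_uIcc_of_mem hab hyt h
      have hnot' : -y + vg k * t ∉ Set.uIcc 0 (vg (-k) * s) := by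
        rw [hvgodd, neg_mul, show -y + vg k * t = -(y - vg k * t) by ring,
          neg_mem_uIcc_zero_neg]
        exact hnot
      rw [Sop_of_mem (hadd ▸ mem_uIcc_add_of_mem hab h), Sop_of_mem h,
        Sop_of_notMem hnot, Sop_of_notMem hnot', hexp, hRteven, hvgodd,
        show y - vg k * (t + s) = y - vg k * t - vg k * s by ring,
        show -y + vg k * (t + s) = -y + vg k * t - -vg k * s by ring]
      ring
    · have hiff := mem_uIcc_add_iff_sub_mem (b := vg k * s) hy h
      rw [← hadd] at hiff
      rw [Sop_of_notMem h]
      by_cases h' : y - vg k * t ∈ Set.uIcc 0 (vg k * s)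
      · rw [Sop_of_mem (hiff.2 h'), Sop_of_mem h', hexp,
          show y - vg k * (t + s) = y - vg k * t - vg k * s by ring,
          show -y + vg k * (t + s) = -(y - vg k * t) + vg k * s by ring]
        ring
      · rw [Sop_of_notMem (mt hiff.1 h'), Sop_of_notMem h', hexp,
          show y - vg k * (t + s) = y - vg k * t - vg k * s by ring]
        ring
  · intro y k hy _
    rw [Sop_of_notMem (by simpa using hy)]
    simp
end
end
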